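/- Let μ ∈ Γ₂ := {a + ib ∈ ℂ : 0 < a < 2/3, 0 < b < √(a(2−3a)/3)}. Then for every ε > 0 there exist an admissible shear flow U_s, K > 0 and γ₊ > 0 such that for every integer k ≥ K and every ν > 0 with (√ν k)⁻¹ ≤ γ₊, there exists μ_{k,ν} ∈ ℂ with Im μ_{k,ν} > 0 and |μ_{k,ν} − μ| ≤ ε, and a smooth function φ : [0,∞) → ℂ satisfying (μ_{k,ν} − U_s)φ' + U_s' φ − (i/k) φ''' = F, φ(0) = 0, φ'(0) = 1, φ'(y) → 0 and φ(y) → 1/(√ν k) as y → ∞. Equivalently, λ_{k,ν} := −i k μ_{k,ν} satisfies |λ_{k,ν}/k + iμ| ≤ ε and the IBL system displays (λ_{k,ν}, k) instabilities. -/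

import Mathlib

open MeasureTheory Filter Set

noncomputable section

/-- The source term `F(y) = 1 - U(y) + y U'(y)` of the eigenmode ODE. -/
def srcF (U : ℝ → ℝ) (y : ℝ) : ℝ := 1 - U y + y * deriv U y

/-- The displacement thickness `Δ_s = ∫₀^∞ (1 - U)`. -/
def deltaS (U : ℝ → ℝ) : ℝ := ∫ y in Ioi (0:ℝ), (1 - U y)

/-- An admissible shear flow: smooth, monotone, `U(0) = 0`, `U → 1`,
`U''(0) ≠ 0`, finitely many inflexion points, and the decay conditions of the paper. -/
structure AdmissibleShearFlow (U : ℝ → ℝ) : Prop where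
  smooth : ContDiff ℝ (⊤ : ℕ∞) U
  mem_Ico : ∀ y, 0 ≤ y → U y ∈ Ico (0:ℝ) 1
  zero_val : U 0 = 0
  deriv_pos : ∀ y, 0 ≤ y → 0 < deriv U y
  tendsto_one : Tendsto U atTop (nhds 1)
  snd_deriv_zero_ne : iteratedDeriv 2 U 0 ≠ 0
  finite_inflexions : {y : ℝ | 0 < y ∧ iteratedDeriv 2 U y = 0}.Finite
  integrable_defect : IntegrableOn (fun y => 1 - U y) (Ioi (0:ℝ))
  derivs_bounded : ∀ j : ℕ, 1 ≤ j → j ≤ 3 →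
    ∃ M : ℝ, ∀ y, 0 ≤ y → |iteratedDeriv j U y| ≤ M
  decay_ratio₁ : Tendsto (fun y => (1 - U y) ^ 2 / deriv U y) atTop (nhds 0)
  decay_ratio₂ : Tendsto (fun y => y * (1 - U y)) atTop (nhds 0)
  decay_ratio₃ : IntegrableOn
    (fun y => (1 - U y) ^ 2 * iteratedDeriv 2 U y / (deriv U y) ^ 2) (Ioi (0:ℝ))
  kappa_decay : ∃ κ : ℝ, 0 < κ ∧ κ < 1/2 ∧ ∃ yκ > (0:ℝ), ∃ cκ > (0:ℝ),
    ∀ y, yκ ≤ y →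
      (1 - U y) ^ ((2:ℝ) - κ) * iteratedDeriv 2 U y ≤ -cκ * (deriv U y) ^ 3

/-- `φ` is a smooth solution of the eigenmode problem
`(μ - U_s)φ' + U_s'φ - (i/k)φ''' = F`, `φ(0) = 0`, `φ'(0) = 1`, `φ' → 0`, `φ → L`. -/
def IsEigSolution (U : ℝ → ℝ) (μ : ℂ) (k : ℝ) (L : ℂ) (φ : ℝ → ℂ) : Prop :=
  ContDiff ℝ (⊤ : ℕ∞) φ ∧
  (∀ y, 0 ≤ y →
    (μ - (U y : ℂ)) * deriv φ y + ((deriv U y : ℝ) : ℂ) * φ y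
      - Complex.I / (k : ℂ) * iteratedDeriv 3 φ y = (srcF U y : ℂ)) ∧
  φ 0 = 0 ∧ deriv φ 0 = 1 ∧
  Tendsto (deriv φ) atTop (nhds 0) ∧
  Tendsto φ atTop (nhds L)

/-- Same problem without the prescribed limit at infinity. -/
def IsBLSolution (U : ℝ → ℝ) (μ : ℂ) (k : ℝ) (φ : ℝ → ℂ) : Prop :=
  ContDiff ℝ (⊤ : ℕ∞) φ ∧
  (∀ y, 0 ≤ y →
    (μ - (U y : ℂ)) * deriv φ y + ((deriv U y : ℝ) : ℂ) * φ y
      - Complex.I / (k : ℂ) * iteratedDeriv 3 φ y = (srcF U y : ℂ)) ∧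
  φ 0 = 0 ∧ deriv φ 0 = 1 ∧ Tendsto (deriv φ) atTop (nhds 0)

/-- Cauchy principal value `PV ∫₀¹ h(u)/(u - a) du`. -/
def pvIntegral (h : ℝ → ℝ) (a : ℝ) : ℝ :=
  limUnder (nhdsWithin (0:ℝ) (Ioi 0))
    (fun ε => ∫ u in Ioo (0:ℝ) 1 \ Ioo (a - ε) (a + ε), h u / (u - a))

/-- Inverse of the shear flow on `[0, ∞)`. -/
def shearInv (U : ℝ → ℝ) (u : ℝ) : ℝ := Function.invFunOn U (Ici 0) u

/-- `g(u) = (1-u)² U''(U⁻¹(u)) / (U'(U⁻¹(u)))³`. -/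
def gfun (U : ℝ → ℝ) (u : ℝ) : ℝ :=
  (1 - u) ^ 2 * iteratedDeriv 2 U (shearInv U u) / (deriv U (shearInv U u)) ^ 3

/-- `G(a) = 1/(a U'(0)) + PV ∫₀¹ g(u)/(u-a) du + iπ g(a)`. -/
def Gfun (U : ℝ → ℝ) (a : ℝ) : ℂ :=
  ((1 / (a * deriv U 0) + pvIntegral (gfun U) a : ℝ) : ℂ)
    + Complex.I * ((Real.pi * gfun U a : ℝ) : ℂ)

/-- Crossing abscissa `χ(y) = Re G(U(y))`. -/
def chiAbscissa (U : ℝ → ℝ) (y : ℝ) : ℝ := (Gfun U (U y)).re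

/-- `ξ(γ)`: number of zeros of `U''` in `(0,∞)` with `χ(yᵢ) = γ`. -/
def xiEq (U : ℝ → ℝ) (γ : ℝ) : ℕ :=
  {y : ℝ | 0 < y ∧ iteratedDeriv 2 U y = 0 ∧ chiAbscissa U y = γ}.ncard

/-- `ξ₊(γ)`: zeros of `U''` with `χ(yᵢ) < γ`, `U'' < 0` on the left and `U'' > 0`
on the right. -/
def xiPlus (U : ℝ → ℝ) (γ : ℝ) : ℕ :=
  {y : ℝ | 0 < y ∧ iteratedDeriv 2 U y = 0 ∧ chiAbscissa U y < γ ∧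
    ∃ δ > (0:ℝ), (∀ z ∈ Ioo (y - δ) y, iteratedDeriv 2 U z < 0) ∧
      (∀ z ∈ Ioo y (y + δ), 0 < iteratedDeriv 2 U z)}.ncard

/-- `ξ₋(γ)`: zeros of `U''` with `χ(yᵢ) < γ`, `U'' > 0` on the left and `U'' < 0`
on the right. -/
def xiMinus (U : ℝ → ℝ) (γ : ℝ) : ℕ :=
  {y : ℝ | 0 < y ∧ iteratedDeriv 2 U y = 0 ∧ chiAbscissa U y < γ ∧
    ∃ δ > (0:ℝ), (∀ z ∈ Ioo (y - δ) y, 0 < iteratedDeriv 2 U z) ∧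
      (∀ z ∈ Ioo y (y + δ), iteratedDeriv 2 U z < 0)}.ncard

/-- `Φ_inv(μ) = (μ - 1) ∫₀^∞ F(y)/(μ - U(y))² dy`. -/
def PhiInv (U : ℝ → ℝ) (μ : ℂ) : ℂ :=
  (μ - 1) * ∫ y in Ioi (0:ℝ), (srcF U y : ℂ) / (μ - (U y : ℂ)) ^ 2

/-- A weight function `ω ≥ 1` with `C_ω < ∞`. -/
structure WeightFn (ω : ℝ → ℝ) : Prop where
  pos : ∀ y, 0 ≤ y → 0 < ω y
  contDiff : ContDiff ℝ 1 ω
  one_le : ∀ y, 0 ≤ y → 1 ≤ ω y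
  integrable_inv : IntegrableOn (fun y => 1 / ω y) (Ioi (0:ℝ))
  deriv_ratio_bdd : ∃ M : ℝ, ∀ y, 0 ≤ y → |deriv ω y / ω y| ≤ M
  log_ratio_bdd : ∃ M : ℝ, ∀ y, 0 ≤ y → Real.log (ω y) / (1 + y) ≤ M

/-- Weighted decay conditions: `(1-U_s) ∈ L²(ω)` and `(1+y)U_s^{(j)} ∈ L²(ω)`, `j = 1,2,3`. -/
def WeightedDecay (U ω : ℝ → ℝ) : Prop :=
  IntegrableOn (fun y => (1 - U y) ^ 2 * ω y) (Ioi (0:ℝ)) ∧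
  ∀ j : ℕ, 1 ≤ j → j ≤ 3 →
    IntegrableOn (fun y => ((1 + y) * iteratedDeriv j U y) ^ 2 * ω y) (Ioi (0:ℝ))

/-- Membership in the weighted space `L²(ω)`. -/
def MemL2w (ω : ℝ → ℝ) (f : ℝ → ℂ) : Prop :=
  IntegrableOn (fun y => ‖f y‖ ^ 2 * ω y) (Ioi (0:ℝ))

/-- The `L²(ω)` norm. -/
def wNorm (ω : ℝ → ℝ) (f : ℝ → ℂ) : ℝ :=
  Real.sqrt (∫ y in Ioi (0:ℝ), ‖f y‖ ^ 2 * ω y)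

/-- `φ` solves the homogeneous-boundary-conditions resolvent problem with forcing `f`. -/
def SolvesHom (U : ℝ → ℝ) (μ : ℂ) (k : ℝ) (f φ : ℝ → ℂ) : Prop :=
  ContDiff ℝ 2 φ ∧
  (∀ᵐ y ∂(volume.restrict (Ioi (0:ℝ))),
    (μ - (U y : ℂ)) * deriv φ y + ((deriv U y : ℝ) : ℂ) * φ y
      - Complex.I / (k : ℂ) * iteratedDeriv 3 φ y = f y) ∧
  φ 0 = 0 ∧ deriv φ 0 = 0 ∧ Tendsto (deriv φ) atTop (nhds 0)

/-- Parameterization on `[0,1]` of the contour `C_η`: the segment from `iη` to `1 + iη`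
followed by the upper half-circle of radius `1/2` centered at `1/2 + iη`. -/
def Ceta (η : ℝ) (t : ℝ) : ℂ :=
  if t ≤ 1/2 then ((2*t : ℝ) : ℂ) + (η : ℂ) * Complex.I
  else (1/2 : ℂ) + (η : ℂ) * Complex.I
    + (1/2 : ℂ) * Complex.exp (((Real.pi * (2*t - 1) : ℝ)) * Complex.I)

/-- Winding number `(1/2πi) ∮ dz/(z - p)` of a closed curve parameterized on `[0,1]`. -/
def windingNumber (c : ℝ → ℂ) (p : ℂ) : ℂ :=
  (((2 * Real.pi : ℝ) : ℂ) * Complex.I)⁻¹ * ∫ t in (0:ℝ)..1, deriv c t / (c t - p)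

/-- `q_μ(x) = |μ - x|⁴ - (2μ - 1 - x)(μ̄ - x)²`. -/
def qmu (μ : ℂ) (x : ℝ) : ℂ :=
  ((‖μ - (x:ℂ)‖ ^ 4 : ℝ) : ℂ) - (2*μ - 1 - (x:ℂ)) * ((starRingEnd ℂ) μ - (x:ℂ))^2

/-- `f(α) = -2iΔ_s/α + 1/√α`, principal square root (positive real part for `Re α > 0`). -/
def fIBL (Δ : ℝ) (α : ℂ) : ℂ := (-2 * Complex.I * (Δ:ℂ)) / α + 1 / (α ^ (1/2 : ℂ))

section

/-! ### The Banach space of bounded continuous functions on the half line -/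

abbrev XX := BoundedContinuousFunction NNReal ℂ

def xext (v : XX) (y : ℝ) : ℂ := v y.toNNReal

lemma xext_cont (v : XX) : Continuous (xext v) :=
  v.continuous.comp continuous_real_toNNReal

lemma xext_norm_le (v : XX) (y : ℝ) : ‖xext v y‖ ≤ ‖v‖ := v.norm_coe_le_norm _

lemma xext_coe (v : XX) (y : NNReal) : xext v (y : ℝ) = v y := by simp [xext]

lemma xext_add (u v : XX) (y : ℝ) : xext (u + v) y = xext u y + xext v y := rfl
lemma xext_sub (u v : XX) (y : ℝ) : xext (u - v) y = xext u y - xext v y := rfl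
lemma xext_mul (u v : XX) (y : ℝ) : xext (u * v) y = xext u y * xext v y := rfl
lemma xext_smul (c : ℂ) (v : XX) (y : ℝ) : xext (c • v) y = c * xext v y := rfl
lemma xext_one (y : ℝ) : xext 1 y = 1 := rfl

lemma xx_ext {u v : XX} (h : ∀ y, 0 ≤ y → xext u y = xext v y) : u = v := by
  ext y
  have := h y y.2
  rwa [xext_coe, xext_coe] at this

lemma xx_norm_le {u : XX} {C : ℝ} (hC : 0 ≤ C) (h : ∀ y, 0 ≤ y → ‖xext u y‖ ≤ C) : ‖u‖ ≤ C := by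
  rw [BoundedContinuousFunction.norm_le hC]
  intro y
  have := h y y.2
  rwa [xext_coe] at this

def mkX (f : ℝ → ℂ) (hc : Continuous f) (C : ℝ) (hb : ∀ y, 0 ≤ y → ‖f y‖ ≤ C) : XX :=
  BoundedContinuousFunction.ofNormedAddCommGroup (fun y : NNReal => f y)
    (hc.comp NNReal.continuous_coe) C (fun y => hb y y.2)

lemma xext_mkX (f : ℝ → ℂ) (hc : Continuous f) (C : ℝ) (hb : ∀ y, 0 ≤ y → ‖f y‖ ≤ C)
    (y : ℝ) (hy : 0 ≤ y) : xext (mkX f hc C hb) y = f y := by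
  simp [xext, mkX, hy]

lemma mkX_norm (f : ℝ → ℂ) (hc : Continuous f) (C : ℝ) (hb : ∀ y, 0 ≤ y → ‖f y‖ ≤ C) :
    ‖mkX f hc C hb‖ ≤ C := by
  refine xx_norm_le ((norm_nonneg _).trans (hb 0 le_rfl)) fun y hy => ?_
  rw [xext_mkX _ _ _ _ _ hy]; exact hb y hy

def mkOp (T : XX → ℝ → ℂ) (hc : ∀ v, Continuous (T v))
    (hadd : ∀ u v y, T (u + v) y = T u y + T v y)
    (hsmul : ∀ (c : ℂ) v y, T (c • v) y = c * T v y) (C : ℝ)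
    (hb : ∀ v y, 0 ≤ y → ‖T v y‖ ≤ C * ‖v‖) : XX →L[ℂ] XX :=
  LinearMap.mkContinuous
    { toFun := fun v => mkX (T v) (hc v) (C * ‖v‖) (hb v)
      map_add' := fun u v => xx_ext fun y hy => by
        rw [xext_add, xext_mkX _ _ _ _ _ hy, xext_mkX _ _ _ _ _ hy, xext_mkX _ _ _ _ _ hy, hadd]
      map_smul' := fun c v => xx_ext fun y hy => by
        rw [RingHom.id_apply, xext_smul, xext_mkX _ _ _ _ _ hy, xext_mkX _ _ _ _ _ hy, hsmul] }
    C (fun v => mkX_norm (T v) (hc v) (C * ‖v‖) (hb v))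

lemma xext_mkOp (T : XX → ℝ → ℂ) (hc hadd hsmul C hb) (v : XX) (y : ℝ) (hy : 0 ≤ y) :
    xext (mkOp T hc hadd hsmul C hb v) y = T v y :=
  xext_mkX (T v) (hc v) (C * ‖v‖) (hb v) y hy

lemma mkOp_norm (T : XX → ℝ → ℂ) (hc hadd hsmul C hb) (v : XX) :
    ‖mkOp T hc hadd hsmul C hb v‖ ≤ C * ‖v‖ :=
  mkX_norm (T v) (hc v) (C * ‖v‖) (hb v)

/-! ### The integral operators -/

def wexp (c : ℝ) (y : ℝ) : ℂ := ((Real.exp (c * y) : ℝ) : ℂ)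

lemma wexp_cont (c : ℝ) : Continuous (wexp c) := by unfold wexp; fun_prop

lemma wexp_norm (c y : ℝ) : ‖wexp c y‖ = Real.exp (c * y) := by
  unfold wexp; rw [Complex.norm_real, Real.norm_eq_abs, abs_of_pos (Real.exp_pos _)]

lemma wexp_deriv (c y : ℝ) : HasDerivAt (wexp c) (c * wexp c y) y := by
  unfold wexp
  have h : HasDerivAt (fun y : ℝ => Real.exp (c * y)) (Real.exp (c * y) * (c * 1)) y :=
    ((hasDerivAt_id y).const_mul c).exp
  have := h.ofReal_comp
  convert this using 1
  push_cast; ring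

lemma wexp_mul_neg (c y : ℝ) : wexp c y * wexp (-c) y = 1 := by
  unfold wexp; rw [← Complex.ofReal_mul, ← Real.exp_add]; simp

lemma wexp_zero (c : ℝ) : wexp c 0 = 1 := by simp [wexp]

lemma intble_wexp_mul (b : ℝ) (hb : 0 < b) (v : XX) (y : ℝ) :
    IntegrableOn (fun s => wexp (-b) s * xext v s) (Ioi y) := by
  have h1 : IntegrableOn (fun s => Real.exp (-b * s) * ‖v‖) (Ioi y) :=
    (integrableOn_exp_mul_Ioi (by linarith) y).mul_const _
  refine Integrable.mono' h1 ((wexp_cont _).mul (xext_cont v)).aestronglyMeasurable ?_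
  refine Eventually.of_forall fun s => ?_
  rw [norm_mul, wexp_norm]
  exact mul_le_mul_of_nonneg_left (xext_norm_le v s) (Real.exp_pos _).le

lemma norm_int_wexp_mul_le (b : ℝ) (hb : 0 < b) (v : XX) (y : ℝ) :
    ‖∫ s in Ioi y, wexp (-b) s * xext v s‖ ≤ Real.exp (-b * y) / b * ‖v‖ := by
  have h1 : IntegrableOn (fun s => Real.exp (-b * s) * ‖v‖) (Ioi y) :=
    (integrableOn_exp_mul_Ioi (by linarith) y).mul_const _
  refine (norm_integral_le_of_norm_le h1 ?_).trans ?_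
  · refine Eventually.of_forall fun s => ?_
    rw [norm_mul, wexp_norm]
    exact mul_le_mul_of_nonneg_left (xext_norm_le v s) (Real.exp_pos _).le
  · rw [integral_mul_const, integral_exp_mul_Ioi (by linarith)]
    rw [neg_div_neg_eq]

def tJ (v : XX) (y : ℝ) : ℂ := ∫ s in (0:ℝ)..y, wexp (-(1/2)) s * xext v s

def tQp (a : ℝ) (v : XX) (y : ℝ) : ℂ := a * wexp (-a) y * ∫ s in (0:ℝ)..y, wexp a s * xext v s

def tQm (b : ℝ) (v : XX) (y : ℝ) : ℂ := b * wexp b y * ∫ s in Ioi y, wexp (-b) s * xext v s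

lemma prim_deriv (c : ℝ) (v : XX) (y : ℝ) :
    HasDerivAt (fun y => ∫ s in (0:ℝ)..y, wexp c s * xext v s) (wexp c y * xext v y) y := by
  have hc : Continuous (fun s => wexp c s * xext v s) := (wexp_cont c).mul (xext_cont v)
  exact intervalIntegral.integral_hasDerivAt_right (hc.intervalIntegrable _ _)
    hc.aestronglyMeasurable.stronglyMeasurableAtFilter hc.continuousAt

lemma tJ_deriv (v : XX) (y : ℝ) : HasDerivAt (tJ v) (wexp (-(1/2)) y * xext v y) y :=
  prim_deriv _ _ _

lemma tQp_deriv (a : ℝ) (v : XX) (y : ℝ) :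
    HasDerivAt (tQp a v) (a * (xext v y - tQp a v y)) y := by
  have h := (((wexp_deriv (-a) y).const_mul (a:ℂ))).mul (prim_deriv a v y)
  refine h.congr_deriv ?_
  unfold tQp
  have := wexp_mul_neg a y
  push_cast
  linear_combination (a * xext v y) * this

lemma tQm_deriv (b : ℝ) (hb : 0 < b) (v : XX) (y : ℝ) :
    HasDerivAt (tQm b v) (b * (tQm b v y - xext v y)) y := by
  have e : (fun y => ∫ s in Ioi y, wexp (-b) s * xext v s)
      = fun y => (∫ s in Ioi 0, wexp (-b) s * xext v s)
        - ∫ s in (0:ℝ)..y, wexp (-b) s * xext v s := by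
    funext z
    rw [← intervalIntegral.integral_Ioi_sub_Ioi' (intble_wexp_mul b hb v 0) (intble_wexp_mul b hb v z)]
    ring
  have h0 : HasDerivAt (fun y => ∫ s in Ioi y, wexp (-b) s * xext v s)
      (- (wexp (-b) y * xext v y)) y := by
    rw [e]; exact (prim_deriv (-b) v y).const_sub _
  have h := (((wexp_deriv b y).const_mul (b:ℂ))).mul h0
  refine h.congr_deriv ?_
  unfold tQm
  have := wexp_mul_neg b y
  linear_combination (-b * xext v y) * this

lemma prim_add (c : ℝ) (u v : XX) (y : ℝ) :
    ∫ s in (0:ℝ)..y, wexp c s * xext (u + v) s =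
      (∫ s in (0:ℝ)..y, wexp c s * xext u s) + ∫ s in (0:ℝ)..y, wexp c s * xext v s := by
  rw [← intervalIntegral.integral_add]
  · simp only [xext_add, mul_add]
  · exact ((wexp_cont c).mul (xext_cont u)).intervalIntegrable _ _
  · exact ((wexp_cont c).mul (xext_cont v)).intervalIntegrable _ _

lemma prim_smul (c : ℝ) (z : ℂ) (v : XX) (y : ℝ) :
    ∫ s in (0:ℝ)..y, wexp c s * xext (z • v) s =
      z * ∫ s in (0:ℝ)..y, wexp c s * xext v s := by
  rw [← intervalIntegral.integral_const_mul]
  congr 1; funext s; rw [xext_smul]; ring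

/-- `J v (y) = ∫₀^y e^{-s/2} v(s) ds`. -/
def opJ : XX →L[ℂ] XX := mkOp tJ
  (fun v => continuous_iff_continuousAt.2 fun y => (tJ_deriv v y).continuousAt)
  (fun u v y => prim_add _ _ _ _) (fun c v y => prim_smul _ _ _ _) 2 (by
    intro v y hy
    unfold tJ
    have hI : IntegrableOn (fun s => Real.exp (-(1/2) * s) * ‖v‖) (Ioi 0) :=
      (integrableOn_exp_mul_Ioi (by norm_num) 0).mul_const _
    have h1 : ‖∫ s in (0:ℝ)..y, wexp (-(1/2)) s * xext v s‖
        ≤ ∫ s in (0:ℝ)..y, Real.exp (-(1/2) * s) * ‖v‖ := by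
      refine intervalIntegral.norm_integral_le_of_norm_le hy ?_ ?_
      · refine Eventually.of_forall fun s _ => ?_
        rw [norm_mul, wexp_norm]
        exact mul_le_mul_of_nonneg_left (xext_norm_le v s) (Real.exp_pos _).le
      · exact Continuous.intervalIntegrable (by fun_prop) _ _
    have h2 : ∫ s in (0:ℝ)..y, Real.exp (-(1/2) * s) * ‖v‖
        ≤ ∫ s in Ioi (0:ℝ), Real.exp (-(1/2) * s) * ‖v‖ := by
      rw [intervalIntegral.integral_of_le hy]
      refine setIntegral_mono_set hI ?_ Ioc_subset_Ioi_self.eventuallyLE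
      exact Eventually.of_forall fun s => by positivity
    rw [integral_mul_const, integral_exp_mul_Ioi (by norm_num)] at h2
    refine h1.trans (h2.trans (le_of_eq ?_))
    norm_num)

/-- Causal exponential averaging. -/
def opQp (a : ℝ) (ha : 0 < a) : XX →L[ℂ] XX := mkOp (tQp a)
  (fun v => continuous_iff_continuousAt.2 fun y => (tQp_deriv a v y).continuousAt)
  (fun u v y => by unfold tQp; rw [prim_add]; ring)
  (fun c v y => by unfold tQp; rw [prim_smul]; ring) 1 (by
    intro v y hy
    unfold tQp
    have h1 : ‖∫ s in (0:ℝ)..y, wexp a s * xext v s‖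
        ≤ ∫ s in (0:ℝ)..y, Real.exp (a * s) * ‖v‖ := by
      refine intervalIntegral.norm_integral_le_of_norm_le hy ?_ ?_
      · refine Eventually.of_forall fun s _ => ?_
        rw [norm_mul, wexp_norm]
        exact mul_le_mul_of_nonneg_left (xext_norm_le v s) (Real.exp_pos _).le
      · exact Continuous.intervalIntegrable (by fun_prop) _ _
    have h2 : ∫ s in (0:ℝ)..y, Real.exp (a * s) * ‖v‖ = (Real.exp (a * y) - 1) / a * ‖v‖ := by
      rw [intervalIntegral.integral_mul_const]
      congr 1
      have hd : ∀ x ∈ uIcc 0 y, HasDerivAt (fun s => Real.exp (a * s) / a) (Real.exp (a * x)) x := by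
        intro x _
        have h : HasDerivAt (fun y : ℝ => Real.exp (a * y)) (Real.exp (a * x) * (a * 1)) x :=
          ((hasDerivAt_id x).const_mul a).exp
        refine (h.div_const a).congr_deriv ?_
        field_simp
      rw [intervalIntegral.integral_eq_sub_of_hasDerivAt hd
        (Continuous.intervalIntegrable (by fun_prop) _ _)]
      simp; ring
    rw [h2] at h1
    have h3 : Real.exp (-a * y) * Real.exp (a * y) = 1 := by rw [← Real.exp_add]; simp
    rw [norm_mul, norm_mul, wexp_norm, Complex.norm_real, Real.norm_of_nonneg ha.le]
    calc a * Real.exp (-a * y) * _ ≤ a * Real.exp (-a * y) * ((Real.exp (a * y) - 1) / a * ‖v‖) := by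
          gcongr
      _ = (Real.exp (-a * y) * Real.exp (a * y) - Real.exp (-a * y)) * ‖v‖ := by field_simp
      _ ≤ 1 * ‖v‖ := by
          rw [h3]
          have := Real.exp_pos (-a * y)
          gcongr; linarith)

/-- Anticausal exponential averaging. -/
def opQm (b : ℝ) (hb : 0 < b) : XX →L[ℂ] XX := mkOp (tQm b)
  (fun v => continuous_iff_continuousAt.2 fun y => (tQm_deriv b hb v y).continuousAt)
  (fun u v y => by
    unfold tQm
    rw [← mul_add, ← integral_add (intble_wexp_mul b hb u y) (intble_wexp_mul b hb v y)]
    simp only [xext_add, mul_add])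
  (fun c v y => by
    unfold tQm
    simp only [xext_smul, mul_left_comm _ c]
    rw [integral_const_mul]; ring) 1 (by
    intro v y hy
    unfold tQm
    rw [norm_mul, norm_mul, wexp_norm, Complex.norm_real, Real.norm_of_nonneg hb.le]
    have h3 : Real.exp (b * y) * Real.exp (-b * y) = 1 := by rw [← Real.exp_add]; simp
    calc b * Real.exp (b * y) * _ ≤ b * Real.exp (b * y) * (Real.exp (-b * y) / b * ‖v‖) := by
          gcongr; exact norm_int_wexp_mul_le b hb v y
      _ = (Real.exp (b * y) * Real.exp (-b * y)) * ‖v‖ := by field_simp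
      _ ≤ 1 * ‖v‖ := by rw [h3])

/-- The functional `v ↦ ∫₀^∞ e^{-s/2} v(s) ds`. -/
def opEll : XX →L[ℂ] ℂ := LinearMap.mkContinuous
  { toFun := fun v => ∫ s in Ioi (0:ℝ), wexp (-(1/2)) s * xext v s
    map_add' := fun u v => by
      rw [← integral_add (intble_wexp_mul (1/2) (by norm_num) u 0)
        (intble_wexp_mul (1/2) (by norm_num) v 0)]
      simp only [xext_add, mul_add]
    map_smul' := fun c v => by
      simp only [xext_smul, mul_left_comm _ c, RingHom.id_apply, smul_eq_mul]
      rw [integral_const_mul] } 2 (fun v => by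
    refine (norm_int_wexp_mul_le (1/2) (by norm_num) v 0).trans (le_of_eq ?_)
    norm_num)

lemma opEll_apply (v : XX) : opEll v = ∫ s in Ioi (0:ℝ), wexp (-(1/2)) s * xext v s := rfl

lemma opEll_norm (v : XX) : ‖opEll v‖ ≤ 2 * ‖v‖ := by
  refine (norm_int_wexp_mul_le (1/2) (by norm_num) v 0).trans (le_of_eq ?_)
  norm_num

lemma xext_J (v : XX) (y : ℝ) (hy : 0 ≤ y) : xext (opJ v) y = tJ v y := xext_mkOp _ _ _ _ _ _ _ _ hy
lemma xext_Qp (a ha) (v : XX) (y : ℝ) (hy : 0 ≤ y) : xext (opQp a ha v) y = tQp a v y :=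
  xext_mkOp _ _ _ _ _ _ _ _ hy
lemma xext_Qm (b hb) (v : XX) (y : ℝ) (hy : 0 ≤ y) : xext (opQm b hb v) y = tQm b v y :=
  xext_mkOp _ _ _ _ _ _ _ _ hy

lemma opJ_norm (v : XX) : ‖opJ v‖ ≤ 2 * ‖v‖ := mkOp_norm _ _ _ _ _ _ _
lemma opQp_norm (a ha) (v : XX) : ‖opQp a ha v‖ ≤ ‖v‖ :=
  (mkOp_norm _ _ _ _ _ _ _).trans (le_of_eq (one_mul _))
lemma opQm_norm (a ha) (v : XX) : ‖opQm a ha v‖ ≤ ‖v‖ :=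
  (mkOp_norm _ _ _ _ _ _ _).trans (le_of_eq (one_mul _))

lemma tendsto_J (v : XX) : Tendsto (xext (opJ v)) atTop (nhds (opEll v)) := by
  have h := intervalIntegral_tendsto_integral_Ioi (0:ℝ)
    (intble_wexp_mul (1/2) (by norm_num) v 0) tendsto_id
  refine h.congr' ?_
  filter_upwards [eventually_ge_atTop (0:ℝ)] with y hy
  rw [xext_J v y hy]; rfl

/-! ### Derivatives -/

/-- The second argument is the derivative of `g` on the open half line. -/
def DD (g g' : XX) : Prop := ∀ y, 0 < y → HasDerivAt (xext g) (xext g' y) y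

lemma DD.add {g g' h h' : XX} (hg : DD g g') (hh : DD h h') : DD (g + h) (g' + h') :=
  fun y hy => (hg y hy).add (hh y hy)
lemma DD.sub {g g' h h' : XX} (hg : DD g g') (hh : DD h h') : DD (g - h) (g' - h') :=
  fun y hy => (hg y hy).sub (hh y hy)
lemma DD.smul {g g' : XX} (c : ℂ) (hg : DD g g') : DD (c • g) (c • g') :=
  fun y hy => (hg y hy).const_mul c
lemma DD.mul {g g' h h' : XX} (hg : DD g g') (hh : DD h h') : DD (g * h) (g' * h + g * h') :=
  fun y hy => (hg y hy).mul (hh y hy)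

lemma hasDerivAt_xext {u : XX} {f : ℝ → ℂ} {f' : ℂ} (h : ∀ y, 0 ≤ y → xext u y = f y) {y : ℝ}
    (hy : 0 < y) (hf : HasDerivAt f f' y) : HasDerivAt (xext u) f' y := by
  refine hf.congr_of_eventuallyEq ?_
  filter_upwards [lt_mem_nhds hy] with z hz using h z hz.le

/-- the function `e^{-l y}` -/
def expX (l : ℂ) (hl : 0 ≤ l.re) : XX :=
  mkX (fun y => Complex.exp (-l * y)) (by fun_prop) 1 (by
    intro y hy
    rw [Complex.norm_exp]
    simp only [Complex.mul_re, Complex.neg_re, Complex.ofReal_re, Complex.neg_im, Complex.ofReal_im]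
    rw [Real.exp_le_one_iff]
    nlinarith)

lemma xext_expX (l hl) (y : ℝ) (hy : 0 ≤ y) : xext (expX l hl) y = Complex.exp (-l * y) :=
  xext_mkX _ _ _ _ _ hy

lemma expX_norm (l hl) : ‖expX l hl‖ ≤ 1 := mkX_norm _ _ _ _

lemma norm_xext_expX (l hl) (y : ℝ) (hy : 0 ≤ y) : ‖xext (expX l hl) y‖ = Real.exp (-l.re * y) := by
  rw [xext_expX _ _ _ hy, Complex.norm_exp]; simp

lemma DD_expX (l hl) : DD (expX l hl) ((-l) • expX l hl) := fun y hy => by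
  refine hasDerivAt_xext (fun z hz => xext_expX l hl z hz) hy ?_
  rw [xext_smul, xext_expX _ _ _ hy.le]
  have h1 : HasDerivAt (fun z : ℝ => -l * (z : ℂ)) (-l * 1) y :=
    (Complex.ofRealCLM.hasDerivAt (x := y)).const_mul (-l)
  refine h1.cexp.congr_deriv ?_
  ring

def Eh : XX := expX ((1/2 : ℝ) : ℂ) (by rw [Complex.ofReal_re]; norm_num)

lemma xext_Eh (y : ℝ) (hy : 0 ≤ y) : xext Eh y = wexp (-(1/2)) y := by
  unfold Eh wexp; rw [xext_expX _ _ _ hy]; push_cast; rfl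

lemma Eh_norm : ‖Eh‖ ≤ 1 := expX_norm _ _

lemma DD_J (v : XX) : DD (opJ v) (Eh * v) := fun y hy => by
  refine hasDerivAt_xext (fun z hz => xext_J v z hz) hy ?_
  rw [xext_mul, xext_Eh y hy.le]; exact tJ_deriv v y

lemma DD_Qp (a ha) (v : XX) : DD (opQp a ha v) ((a:ℂ) • (v - opQp a ha v)) := fun y hy => by
  refine hasDerivAt_xext (fun z hz => xext_Qp a ha v z hz) hy ?_
  rw [xext_smul, xext_sub, xext_Qp _ _ _ _ hy.le]; exact tQp_deriv a v y

lemma DD_Qm (a ha) (v : XX) : DD (opQm a ha v) ((a:ℂ) • (opQm a ha v - v)) := fun y hy => by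
  refine hasDerivAt_xext (fun z hz => xext_Qm a ha v z hz) hy ?_
  rw [xext_smul, xext_sub, xext_Qm _ _ _ _ hy.le]; exact tQm_deriv a ha v y

lemma J_zero (v : XX) : xext (opJ v) 0 = 0 := by rw [xext_J v 0 le_rfl]; simp [tJ]
lemma Qp_zero (a ha) (v : XX) : xext (opQp a ha v) 0 = 0 := by
  rw [xext_Qp _ _ v 0 le_rfl]; simp [tQp]

lemma const_of_deriv_zero {f : ℝ → ℂ} (hc : Continuous f)
    (hd : ∀ y, 0 < y → HasDerivAt f 0 y) (y : ℝ) (hy : 0 ≤ y) : f y = f 0 := by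
  refine constant_of_has_deriv_right_zero (a := 0) (b := y) hc.continuousOn ?_ y ⟨hy, le_rfl⟩
  intro x hx
  rcases hx.1.eq_or_lt with h | h
  · subst h
    refine hasDerivWithinAt_Ici_of_tendsto_deriv (s := Ioi 0)
      (fun z hz => (hd z hz).differentiableAt.differentiableWithinAt)
      hc.continuousWithinAt self_mem_nhdsWithin ?_
    refine Tendsto.congr' ?_ tendsto_const_nhds
    filter_upwards [self_mem_nhdsWithin] with z hz using ((hd z hz).deriv).symm
  · exact (hd x h).hasDerivWithinAt

lemma DD_unique {g h d : XX} (hg : DD g d) (hh : DD h d) (h0 : xext g 0 = xext h 0) : g = h := by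
  refine xx_ext fun y hy => ?_
  have := const_of_deriv_zero (f := fun y => xext g y - xext h y)
    ((xext_cont g).sub (xext_cont h)) (fun z hz => ((hg z hz).sub (hh z hz)).congr_deriv (sub_self _)) y hy
  simp only [h0, sub_self] at this
  exact sub_eq_zero.1 this

lemma Qm_of_DD (b hb) {g g' : XX} (hg : DD g g') : opQm b hb (g - (b:ℂ)⁻¹ • g') = g := by
  set h := g - (b:ℂ)⁻¹ • g' with hh
  have hb' : (b:ℂ) ≠ 0 := by exact_mod_cast hb.ne'
  have key := const_of_deriv_zero (f := fun y => wexp (-b) y * (xext (opQm b hb h) y - xext g y))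
    ((wexp_cont _).mul ((xext_cont _).sub (xext_cont g))) (fun z hz => by
      refine ((wexp_deriv (-b) z).mul ((DD_Qm b hb h z hz).sub (hg z hz))).congr_deriv ?_
      have e : xext h z = xext g z - (b:ℂ)⁻¹ * xext g' z := rfl
      rw [xext_smul, xext_sub, e, Pi.sub_apply]
      push_cast
      field_simp
      ring)
  have lim : Tendsto (fun y => wexp (-b) y * (xext (opQm b hb h) y - xext g y)) atTop (nhds 0) := by
    rw [tendsto_zero_iff_norm_tendsto_zero]
    have h1 : Tendsto (fun y => Real.exp (-b * y) * ‖opQm b hb h - g‖) atTop (nhds 0) := by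
      have : Tendsto (fun y : ℝ => Real.exp (-b * y)) atTop (nhds 0) :=
        Real.tendsto_exp_atBot.comp (tendsto_id.const_mul_atTop_of_neg (by linarith))
      simpa using this.mul_const ‖opQm b hb h - g‖
    refine squeeze_zero (fun _ => norm_nonneg _) (fun y => ?_) h1
    rw [norm_mul, wexp_norm]
    exact mul_le_mul_of_nonneg_left (xext_norm_le (opQm b hb h - g) y) (Real.exp_pos _).le
  have h0 : wexp (-b) 0 * (xext (opQm b hb h) 0 - xext g 0) = 0 := by
    refine tendsto_nhds_unique ?_ lim
    refine Tendsto.congr' ?_ tendsto_const_nhds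
    filter_upwards [eventually_ge_atTop (0:ℝ)] with y hy using (key y hy).symm
  refine xx_ext fun y hy => ?_
  have h1 := key y hy
  simp only [h0] at h1
  have h2 : wexp (-b) y ≠ 0 := by
    intro h; have := wexp_mul_neg (-b) y; rw [h] at this; simp at this
  exact sub_eq_zero.1 ((mul_eq_zero.1 h1).resolve_left h2)

def ea (a : ℝ) (ha : 0 < a) : XX := expX (a:ℂ) (by rw [Complex.ofReal_re]; exact ha.le)

lemma ea_norm (a ha) : ‖ea a ha‖ ≤ 1 := expX_norm _ _

lemma xext_ea (a ha) (y : ℝ) (hy : 0 ≤ y) : xext (ea a ha) y = wexp (-a) y := by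
  unfold ea wexp; rw [xext_expX _ _ _ hy]; push_cast; rfl

lemma DD_ea (a ha) : DD (ea a ha) ((-(a:ℂ)) • ea a ha) := DD_expX _ _

lemma Qp_of_DD (a ha) {g g' : XX} (hg : DD g g') :
    opQp a ha (g + (a:ℂ)⁻¹ • g') = g - xext g 0 • ea a ha := by
  set h := g + (a:ℂ)⁻¹ • g' with hh
  have hb' : (a:ℂ) ≠ 0 := by exact_mod_cast ha.ne'
  have key := const_of_deriv_zero (f := fun y => wexp a y * (xext (opQp a ha h) y - xext g y))
    ((wexp_cont _).mul ((xext_cont _).sub (xext_cont g))) (fun z hz => by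
      refine ((wexp_deriv a z).mul ((DD_Qp a ha h z hz).sub (hg z hz))).congr_deriv ?_
      have e : xext h z = xext g z + (a:ℂ)⁻¹ * xext g' z := rfl
      rw [xext_smul, xext_sub, e, Pi.sub_apply]
      field_simp
      ring)
  refine xx_ext fun y hy => ?_
  have h1 := key y hy
  simp only [Qp_zero, wexp_zero] at h1
  rw [xext_sub, xext_smul, xext_ea a ha y hy]
  have := wexp_mul_neg a y
  linear_combination (wexp (-a) y) * h1 + (xext g y - xext (opQp a ha h) y) * this

end

section

/-! ### Coefficients -/

structure Coef where
  u : ℝ → ℝ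
  UX : XX
  U1 : XX
  U1d : XX
  ff : XX
  ffd : XX
  G : ℝ
  hG : 1 ≤ G
  hu : Continuous u
  hUX : ∀ y, 0 ≤ y → xext UX y = (u y : ℂ)
  u_nonneg : ∀ y, 0 ≤ y → 0 ≤ u y
  u_le : ∀ y, 0 ≤ y → u y ≤ 1
  u_lip : ∀ y, 0 ≤ y → u y ≤ G * y
  dU : DD UX (Eh * U1)
  dU1 : DD U1 U1d
  dff : DD ff ffd
  u_zero : u 0 = 0
  ff_zero : xext ff 0 = 1
  bU1 : ‖U1‖ ≤ G
  bU1d : ‖U1d‖ ≤ G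
  bff : ‖ff‖ ≤ G
  bffd : ‖ffd‖ ≤ G

lemma DD.congr {g g' h' : XX} (hg : DD g g') (e : g' = h') : DD g h' := e ▸ hg

lemma DD_one : DD 1 0 := fun y _ => by
  have : xext 1 = fun _ => (1:ℂ) := rfl
  rw [this]; exact hasDerivAt_const _ _

namespace Coef
variable (c : Coef)

lemma UX_zero : xext c.UX 0 = 0 := by rw [c.hUX 0 le_rfl, c.u_zero]; simp

/-- `μ - U` -/
def Nx (μ : ℂ) : XX := μ • (1 : XX) - c.UX

lemma Nx_apply (μ : ℂ) (y : ℝ) (hy : 0 ≤ y) : xext (c.Nx μ) y = μ - c.u y := by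
  unfold Nx; rw [xext_sub, xext_smul, xext_one, c.hUX y hy, mul_one]

lemma den_bound (μ : ℂ) (b0 : ℝ) (hb0 : 0 < b0) (h : b0 ≤ μ.im) (x : ℝ) : ‖(μ - (x:ℂ))⁻¹‖ ≤ b0⁻¹ := by
  rw [norm_inv]
  refine inv_anti₀ hb0 ?_
  have := Complex.abs_im_le_norm (μ - x)
  simp only [Complex.sub_im, Complex.ofReal_im, sub_zero] at this
  exact h.trans ((le_abs_self _).trans this)

lemma den_ne (μ : ℂ) (h : 0 < μ.im) (x : ℝ) : μ - (x:ℂ) ≠ 0 := by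
  intro e
  have := congrArg Complex.im e
  simp at this; linarith

def Mx (μ : ℂ) (h : 0 < μ.im) : XX :=
  mkX (fun y => (μ - (c.u y : ℂ))⁻¹)
    ((continuous_const.sub (Complex.continuous_ofReal.comp c.hu)).inv₀ fun y => den_ne μ h _)
    (μ.im)⁻¹ (fun y _ => den_bound μ _ h le_rfl _)

lemma Mx_apply (μ : ℂ) (h) (y : ℝ) (hy : 0 ≤ y) : xext (c.Mx μ h) y = (μ - c.u y)⁻¹ :=
  xext_mkX _ _ _ _ _ hy

lemma Mx_norm (μ : ℂ) (h) (b0 : ℝ) (hb0 : 0 < b0) (hb : b0 ≤ μ.im) : ‖c.Mx μ h‖ ≤ b0⁻¹ :=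
  (mkX_norm _ _ _ _).trans (inv_anti₀ hb0 hb)

lemma NM (μ : ℂ) (h) : c.Nx μ * c.Mx μ h = 1 := xx_ext fun y hy => by
  rw [xext_mul, c.Nx_apply _ _ hy, c.Mx_apply _ _ _ hy, xext_one]
  exact mul_inv_cancel₀ (den_ne μ h _)

lemma dN (μ : ℂ) : DD (c.Nx μ) (-(Eh * c.U1)) :=
  ((DD_one.smul μ).sub c.dU).congr (by rw [smul_zero, zero_sub])

lemma dM (μ : ℂ) (h) : DD (c.Mx μ h) (c.Mx μ h * c.Mx μ h * Eh * c.U1) := fun y hy => by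
  have h1 := c.dN μ y hy
  have h2 : HasDerivAt (fun z => (xext (c.Nx μ) z)⁻¹) _ y := h1.inv (by
    rw [c.Nx_apply _ _ hy.le]; exact den_ne μ h _)
  refine hasDerivAt_xext (f := fun z => (xext (c.Nx μ) z)⁻¹)
    (fun z hz => by rw [c.Mx_apply _ _ _ hz, c.Nx_apply _ _ hz]) hy (h2.congr_deriv ?_)
  have e : xext (-(Eh * c.U1)) y = -(xext Eh y * xext c.U1 y) := rfl
  rw [e, c.Nx_apply _ _ hy.le]
  simp only [xext_mul]
  rw [c.Mx_apply _ _ _ hy.le, neg_neg, div_eq_mul_inv, ← inv_pow]; ring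

lemma J_id1 (μ : ℂ) (h) (g : XX) :
    opJ (c.U1 * opJ (c.Mx μ h * g)) = opJ g - c.Nx μ * opJ (c.Mx μ h * g) := by
  refine DD_unique (DD_J _) (((DD_J g).sub ((c.dN μ).mul (DD_J _))).congr ?_) ?_
  · have : c.Nx μ * (Eh * (c.Mx μ h * g)) = Eh * g := by
      rw [show c.Nx μ * (Eh * (c.Mx μ h * g)) = (c.Nx μ * c.Mx μ h) * (Eh * g) by ring, c.NM, one_mul]
    rw [this]; ring
  · simp only [xext_sub, xext_mul, J_zero]; simp

lemma J_id2 (μ : ℂ) (h) (g : XX) :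
    opJ (c.Mx μ h * c.Mx μ h * c.U1 * opJ g) = c.Mx μ h * opJ g - opJ (c.Mx μ h * g) := by
  refine DD_unique (DD_J _) ((((c.dM μ h).mul (DD_J g)).sub (DD_J _)).congr ?_) ?_
  · ring
  · simp only [xext_sub, xext_mul, J_zero]; simp

/-- `V v = U1 * J v` -/
def Vop : XX →L[ℂ] XX := (ContinuousLinearMap.mul ℂ XX c.U1).comp opJ

lemma Vop_apply (v : XX) : c.Vop v = c.U1 * opJ v := rfl

lemma Vop_norm (v : XX) : ‖c.Vop v‖ ≤ 2 * c.G * ‖v‖ := by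
  rw [Vop_apply]
  refine (norm_mul_le _ _).trans ?_
  have := opJ_norm v
  have h2 := c.bU1
  have h3 := c.hG
  have h4 : 0 ≤ c.G := by linarith
  calc ‖c.U1‖ * ‖opJ v‖ ≤ c.G * (2 * ‖v‖) := by gcongr
    _ = _ := by ring

def Bop (μ : ℂ) (h : 0 < μ.im) : XX →L[ℂ] XX := (ContinuousLinearMap.mul ℂ XX (c.Mx μ h)).comp c.Vop
def Wop (μ : ℂ) (h : 0 < μ.im) : XX →L[ℂ] XX := c.Vop.comp (ContinuousLinearMap.mul ℂ XX (c.Mx μ h))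

lemma Bop_apply (μ h) (v : XX) : c.Bop μ h v = c.Mx μ h * (c.U1 * opJ v) := rfl
lemma Wop_apply (μ h) (v : XX) : c.Wop μ h v = c.U1 * opJ (c.Mx μ h * v) := rfl

lemma BW (μ h) : (1 + c.Bop μ h) * (1 - c.Wop μ h) = 1 := by
  ext1 g
  show (g - c.Wop μ h g) + c.Bop μ h (g - c.Wop μ h g) = g
  rw [Bop_apply, Wop_apply, map_sub, J_id1, sub_sub_cancel]
  linear_combination (c.U1 * opJ (c.Mx μ h * g)) * c.NM μ h

lemma WB (μ h) : (1 - c.Wop μ h) * (1 + c.Bop μ h) = 1 := by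
  ext1 g
  show (g + c.Bop μ h g) - c.Wop μ h (g + c.Bop μ h g) = g
  rw [Bop_apply, Wop_apply, mul_add, map_add]
  rw [show c.Mx μ h * (c.Mx μ h * (c.U1 * opJ g)) = c.Mx μ h * c.Mx μ h * c.U1 * opJ g by ring, J_id2]
  ring

end Coef

/-! ### Abstract perturbation lemma -/

lemma unit_pert {S A : XX →L[ℂ] XX} (hS : IsUnit S) {C δ : ℝ} (hC : 0 ≤ C)
    (hSb : ∀ x, ‖x‖ ≤ C * ‖S x‖) (hδ : 0 ≤ δ) (hA : ∀ x, ‖A x - S x‖ ≤ δ * ‖x‖) (hCd : C * δ ≤ 1/2) :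
    IsUnit A ∧ ∀ x, ‖x‖ ≤ 2 * C * ‖A x‖ := by
  obtain ⟨s, rfl⟩ := hS
  set T : XX →L[ℂ] XX := ↑s⁻¹ with hT
  have hST : (s : XX →L[ℂ] XX) * T = 1 := s.mul_inv
  have hTn : ‖T‖ ≤ C := by
    refine T.opNorm_le_bound hC fun x => ?_
    have := hSb (T x)
    have e : (s : XX →L[ℂ] XX) (T x) = x := by
      have := congrArg (fun F : XX →L[ℂ] XX => F x) hST
      exact this
    rwa [e] at this
  have hE : ‖A - s‖ ≤ δ := ContinuousLinearMap.opNorm_le_bound _ hδ hA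
  constructor
  · have h1 : ‖-(T * (A - s))‖ < 1 := by
      rw [norm_neg]
      calc ‖T * (A - s)‖ ≤ ‖T‖ * ‖A - s‖ := norm_mul_le _ _
        _ ≤ C * δ := by gcongr
        _ < 1 := by linarith
    have h2 : A = s * (1 - -(T * (A - s))) := by
      rw [sub_neg_eq_add, mul_add, ← mul_assoc, hST, one_mul, mul_one]; abel
    have h3 : IsUnit (1 - -(T * (A - s))) := by
      generalize -(T * (A - s)) = Q at h1
      exact (Units.oneSub Q h1).isUnit
    rw [h2]
    exact s.isUnit.mul h3
  · intro x
    have h1 := hSb x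
    have h2 := hA x
    have h3 : ‖(s : XX →L[ℂ] XX) x‖ ≤ ‖A x‖ + δ * ‖x‖ := by
      have : (s : XX →L[ℂ] XX) x = A x - (A x - (s : XX →L[ℂ] XX) x) := by abel
      rw [this]; exact (norm_sub_le _ _).trans (by linarith)
    have h4 : C * ‖(s : XX →L[ℂ] XX) x‖ ≤ C * ‖A x‖ + C * δ * ‖x‖ := by
      calc _ ≤ C * (‖A x‖ + δ * ‖x‖) := by gcongr
        _ = _ := by ring
    have h5 : C * δ * ‖x‖ ≤ 1/2 * ‖x‖ := by gcongr
    linarith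

lemma unit_oneSub {Q : XX →L[ℂ] XX} {q : ℝ} (hq0 : 0 ≤ q) (hq : q < 1) (hQ : ∀ x, ‖Q x‖ ≤ q * ‖x‖) :
    IsUnit (1 - Q) ∧ ∀ x, ‖x‖ ≤ (1 - q)⁻¹ * ‖(1 - Q) x‖ := by
  refine ⟨(Units.oneSub Q ((Q.opNorm_le_bound hq0 hQ).trans_lt hq)).isUnit, fun x => ?_⟩
  have h1 := hQ x
  have h2 : ‖x‖ ≤ ‖(1 - Q) x‖ + ‖Q x‖ := by
    have : x = (1 - Q) x + Q x := by
      show x = (x - Q x) + Q x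
      abel
    conv_lhs => rw [this]
    exact norm_add_le _ _
  rw [inv_mul_eq_div, le_div_iff₀ (by linarith)]
  linarith

end

section

/-! ### The smoothing operator -/

def Pop (a : ℝ) (ha : 0 < a) : XX →L[ℂ] XX := (opQp a ha).comp (opQm (a+1) (by linarith))

lemma Pop_norm (a ha) (v : XX) : ‖Pop a ha v‖ ≤ ‖v‖ := (opQp_norm a ha _).trans (opQm_norm _ _ _)

lemma Pop_DD (a : ℝ) (ha) {g g' : XX} (hg : DD g g') :
    ‖Pop a ha g - g + xext g 0 • ea a ha‖ ≤ 2 / a * ‖g'‖ := by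
  have hb : 0 < a + 1 := by linarith
  have h1 := Qm_of_DD (a+1) hb hg
  have h2 := Qp_of_DD a ha hg
  rw [map_sub, map_smul, sub_eq_iff_eq_add] at h1
  rw [map_add, map_smul, ← eq_sub_iff_add_eq] at h2
  have e : Pop a ha g - g + xext g 0 • ea a ha
      = ((a+1 : ℝ) : ℂ)⁻¹ • opQp a ha (opQm (a+1) hb g') - (a:ℂ)⁻¹ • opQp a ha g' := by
    show opQp a ha (opQm (a+1) hb g) - g + xext g 0 • ea a ha = _
    rw [h1, map_add, map_smul, h2]; abel
  rw [e]
  refine (norm_sub_le _ _).trans ?_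
  rw [norm_smul, norm_smul, norm_inv, norm_inv, Complex.norm_real, Complex.norm_real,
    Real.norm_of_nonneg hb.le, Real.norm_of_nonneg ha.le]
  have h3 := (opQp_norm a ha (opQm (a+1) hb g')).trans (opQm_norm _ _ _)
  have h4 := opQp_norm a ha g'
  have h5 : (a+1)⁻¹ ≤ a⁻¹ := inv_anti₀ ha (by linarith)
  calc _ ≤ a⁻¹ * ‖g'‖ + a⁻¹ * ‖g'‖ := by gcongr
    _ = _ := by ring

lemma Pop_expX (a : ℝ) (ha) (l : ℂ) (hl : 0 ≤ l.re) (m0 : ℂ)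
    (hm : (a + 1 + l) * (a - l) = m0 * (a * (a + 1))) :
    Pop a ha (m0 • expX l hl) = expX l hl - ea a ha := by
  have hb : 0 < a + 1 := by linarith
  have ha' : (a:ℂ) ≠ 0 := by exact_mod_cast ha.ne'
  have hb' : ((a:ℂ) + 1) ≠ 0 := by exact_mod_cast hb.ne'
  have h1 := Qm_of_DD (a+1) hb (DD_expX l hl)
  have h2 := Qp_of_DD a ha (DD_expX l hl)
  have e0 : xext (expX l hl) 0 = 1 := by rw [xext_expX _ _ _ le_rfl]; simp
  rw [e0, one_smul] at h2
  rw [← h2]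
  have e1 : m0 • expX l hl = (1 - (a:ℂ)⁻¹ * l) • (expX l hl - ((a+1:ℝ):ℂ)⁻¹ • (-l) • expX l hl) := by
    rw [smul_smul, show (expX l hl - (((a+1:ℝ):ℂ)⁻¹ * -l) • expX l hl)
      = (1 - ((a+1:ℝ):ℂ)⁻¹ * -l) • expX l hl by rw [sub_smul, one_smul], smul_smul]
    congr 1
    push_cast
    field_simp
    linear_combination -hm
  rw [e1, map_smul]
  show (1 - (a:ℂ)⁻¹ * l) • opQp a ha (opQm (a+1) hb _) = _
  rw [h1, ← map_smul]
  congr 1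
  rw [sub_smul, one_smul, smul_smul]
  rw [mul_neg, neg_smul, sub_eq_add_neg]

lemma norm_J_expX (l : ℂ) (hl : 0 < l.re) : ‖opJ (expX l hl.le)‖ ≤ 1 / l.re := by
  refine xx_norm_le (by positivity) fun y hy => ?_
  rw [xext_J _ _ hy]
  unfold tJ
  have hi : ∀ y : ℝ, 0 ≤ y → ∫ s in (0:ℝ)..y, Real.exp (-l.re * s) ≤ 1 / l.re := by
    intro y hy
    rw [intervalIntegral.integral_of_le hy]
    have h1 : IntegrableOn (fun s => Real.exp (-l.re * s)) (Ioi 0) :=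
      integrableOn_exp_mul_Ioi (by linarith) 0
    refine (setIntegral_mono_set h1 (Eventually.of_forall fun s => (Real.exp_pos _).le)
      (HasSubset.Subset.eventuallyLE Ioc_subset_Ioi_self)).trans (le_of_eq ?_)
    rw [integral_exp_mul_Ioi (by linarith)]
    simp
  refine (intervalIntegral.norm_integral_le_of_norm_le hy (g := fun s => Real.exp (-l.re * s)) ?_ ?_).trans (hi y hy)
  · refine Eventually.of_forall fun s hs => ?_
    rw [norm_mul, wexp_norm, norm_xext_expX _ _ _ hs.1.le]
    have : Real.exp (-(1/2) * s) ≤ 1 := Real.exp_le_one_iff.2 (by linarith [hs.1])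
    exact mul_le_of_le_one_left (Real.exp_pos _).le this
  · exact Continuous.intervalIntegrable (by fun_prop) _ _

lemma norm_ell_expX (l : ℂ) (hl : 0 < l.re) : ‖opEll (expX l hl.le)‖ ≤ 1 / l.re := by
  refine le_of_tendsto (tendsto_J (expX l hl.le)).norm (Eventually.of_forall fun y => ?_)
  exact (xext_norm_le _ _).trans (norm_J_expX l hl)

namespace Coef
variable (c : Coef)

def mx (R e : ℝ) (μ : ℂ) : XX := (1 + (e:ℂ)) • (1:XX) + (Complex.I / R) • c.Nx μ

def Aop (a : ℝ) (ha : 0 < a) (R e : ℝ) (μ : ℂ) : XX →L[ℂ] XX :=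
  1 - (Pop a ha).comp (ContinuousLinearMap.mul ℂ XX (c.mx R e μ))
    - (Complex.I / R) • (Pop a ha).comp c.Vop

lemma Aop_apply (a ha R e μ) (v : XX) : c.Aop a ha R e μ v
    = v - Pop a ha (c.mx R e μ * v) - (Complex.I / R) • Pop a ha (c.U1 * opJ v) := rfl

lemma mx_norm (R e : ℝ) (μ : ℂ) (b0 C0 : ℝ) (hb0 : 0 < b0) (hb : b0 ≤ μ.im) (hC : ‖μ‖ ≤ C0)
    (hR : 5 * (C0 + 1)^2 ≤ b0 * R) (hRC : C0 ≤ R) (he : 0 ≤ e) (he' : 8 * R * e ≤ b0) :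
    ‖c.mx R e μ‖ ≤ 1 - b0 / (2 * R) := by
  have hbC : b0 ≤ C0 := hb.trans ((Complex.im_le_norm μ).trans hC)
  have hR0 : 0 < R := by linarith
  have hbR : b0 / (2*R) ≤ 1/2 := by rw [div_le_iff₀ (by linarith)]; linarith
  refine xx_norm_le (by linarith) fun y hy => ?_
  have e1 : xext (c.mx R e μ) y = (1 + e) + Complex.I / R * (μ - c.u y) := by
    unfold mx; rw [xext_add, xext_smul, xext_smul, xext_one, c.Nx_apply _ _ hy, mul_one]
  have hre : (xext (c.mx R e μ) y).re = 1 + e - μ.im / R := by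
    rw [e1]; simp [Complex.div_re, Complex.div_im]; field_simp
    try ring
  have him : (xext (c.mx R e μ) y).im = (μ.re - c.u y) / R := by
    rw [e1]; simp [Complex.div_re, Complex.div_im]; field_simp
    try ring
  have h0 := c.u_nonneg y hy
  have h1 := c.u_le y hy
  have hre' := (Complex.abs_re_le_norm μ).trans hC
  have him' := (Complex.im_le_norm μ).trans hC
  rw [abs_le] at hre'
  refine le_of_sq_le_sq ?_ (by linarith) 
  rw [← Complex.normSq_eq_norm_sq, Complex.normSq_apply, hre, him]
  set t := b0 / R with ht
  have htR : b0 = t * R := by rw [ht]; field_simp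
  have ht0 : 0 < t := by positivity
  have ht1 : t ≤ 1 := by rw [ht, div_le_one hR0]; linarith
  have e2 : b0 / (2*R) = t/2 := by rw [ht]; field_simp
  have hx : 1 + e - μ.im / R ≤ 1 - 7/8 * t := by
    have : e ≤ t / 8 := by rw [ht]; rw [div_div, le_div_iff₀ (by positivity)]; linarith
    have h2 : t ≤ μ.im / R := by rw [ht]; gcongr
    linarith
  have hx0 : 0 ≤ 1 + e - μ.im / R := by
    have : μ.im / R ≤ 1 := by rw [div_le_one hR0]; linarith
    linarith
  have hy2 : ((μ.re - c.u y) / R)^2 ≤ t / 5 := by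
    rw [div_pow, div_le_iff₀ (by positivity)]
    have : (μ.re - c.u y)^2 ≤ (C0+1)^2 := sq_le_sq' (by linarith) (by linarith)
    rw [htR] at hR
    nlinarith
  rw [e2]
  nlinarith

end Coef

end

section

namespace Coef
variable (c : Coef)

lemma G_pos : 0 < c.G := lt_of_lt_of_le one_pos c.hG

def CS (b0 R1 : ℝ) : ℝ := 2 * R1 * b0⁻¹ * (1 + 2 * c.G * b0⁻¹)
def Ce (b0 : ℝ) : ℝ := 2 * (2 * b0⁻¹^2 * c.G^2 + 3 * b0⁻¹ * c.G) + 2 * c.G * b0⁻¹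

lemma dB (μ h) (v : XX) : DD (c.Bop μ h v) (c.Mx μ h * c.Mx μ h * Eh * c.U1 * (c.U1 * opJ v)
    + c.Mx μ h * (c.U1d * opJ v + c.U1 * (Eh * v))) :=
  (c.dM μ h).mul (c.dU1.mul (DD_J v))

lemma nmul {u v : XX} {A B : ℝ} (hu : ‖u‖ ≤ A) (hv : ‖v‖ ≤ B) : ‖u * v‖ ≤ A * B :=
  (norm_mul_le _ _).trans (mul_le_mul hu hv (norm_nonneg _) ((norm_nonneg _).trans hu))

lemma dB_norm (μ h) (b0 : ℝ) (hb0 : 0 < b0) (hb : b0 ≤ μ.im) (v : XX) :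
    ‖c.Mx μ h * c.Mx μ h * Eh * c.U1 * (c.U1 * opJ v)
    + c.Mx μ h * (c.U1d * opJ v + c.U1 * (Eh * v))‖
      ≤ (2 * b0⁻¹^2 * c.G^2 + 3 * b0⁻¹ * c.G) * ‖v‖ := by
  have hM := c.Mx_norm μ h b0 hb0 hb
  have h1 := nmul (nmul (nmul (nmul hM hM) Eh_norm) c.bU1) (nmul c.bU1 (opJ_norm v))
  have h2 := nmul hM ((norm_add_le _ _).trans
    (add_le_add (nmul c.bU1d (opJ_norm v)) (nmul c.bU1 (nmul Eh_norm (le_refl ‖v‖)))))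
  refine (norm_add_le _ _).trans ((add_le_add h1 h2).trans (le_of_eq ?_))
  ring

lemma B_norm (μ h) (b0 : ℝ) (hb0 : 0 < b0) (hb : b0 ≤ μ.im) (v : XX) :
    ‖c.Bop μ h v‖ ≤ 2 * c.G * b0⁻¹ * ‖v‖ :=
  (nmul (c.Mx_norm μ h b0 hb0 hb) (nmul c.bU1 (opJ_norm v))).trans (le_of_eq (by ring))

lemma W_norm (μ h) (b0 : ℝ) (hb0 : 0 < b0) (hb : b0 ≤ μ.im) (v : XX) :
    ‖(1 - c.Wop μ h) v‖ ≤ (1 + 2 * c.G * b0⁻¹) * ‖v‖ := by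
  show ‖v - c.U1 * opJ (c.Mx μ h * v)‖ ≤ _
  have h1 := nmul (c.Mx_norm μ h b0 hb0 hb) (le_refl ‖v‖)
  have h2 := nmul c.bU1 ((opJ_norm (c.Mx μ h * v)).trans (mul_le_mul_of_nonneg_left h1 (by norm_num)))
  refine (norm_sub_le _ _).trans ?_
  linarith

lemma A_unit (a : ℝ) (ha : 0 < a) (R e : ℝ) (μ : ℂ) (b0 C0 R1 : ℝ) (hb0 : 0 < b0) (hb : b0 ≤ μ.im)
    (hC : ‖μ‖ ≤ C0) (hR : 5 * (C0 + 1)^2 ≤ b0 * R) (hRC : C0 ≤ R) (he : 0 ≤ e) (he' : 8 * R * e ≤ b0)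
    (hR1 : R ≤ R1) (hea : e ≤ 1 / a) (ha0 : 2 * (c.CS b0 R1) * c.Ce b0 ≤ a) :
    IsUnit (c.Aop a ha R e μ) ∧ ∀ x, ‖x‖ ≤ 2 * c.CS b0 R1 * ‖c.Aop a ha R e μ x‖ := by
  have hμ : 0 < μ.im := hb0.trans_le hb
  have hbC : b0 ≤ C0 := hb.trans ((Complex.im_le_norm μ).trans hC)
  have hR0 : 0 < R := by linarith
  have hG := c.G_pos
  have hR10 : 0 < R1 := by linarith
  have hi : 0 < b0⁻¹ := by positivity
  have hCS : 0 < c.CS b0 R1 := by unfold CS; positivity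
  have hCe : 0 < c.Ce b0 := by unfold Ce; positivity
  have hm := c.mx_norm R e μ b0 C0 hb0 hb hC hR hRC he he'
  have hbR : b0 / (2*R) ≤ 1/2 := by rw [div_le_iff₀ (by linarith)]; linarith
  have hbR' : 0 < b0 / (2*R) := by positivity
  set Q := (Pop a ha).comp (ContinuousLinearMap.mul ℂ XX (c.mx R e μ)) with hQ
  obtain ⟨u1, u2⟩ := unit_oneSub (Q := Q) (q := 1 - b0/(2*R)) (by linarith) (by linarith)
    (fun x => (Pop_norm a ha _).trans (nmul hm le_rfl))
  have uB : IsUnit (1 + c.Bop μ hμ) := ⟨⟨_, _, c.BW μ hμ, c.WB μ hμ⟩, rfl⟩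
  refine unit_pert (S := (1 - Q) * (1 + c.Bop μ hμ)) (u1.mul uB) (C := c.CS b0 R1) (δ := c.Ce b0 / a)
    hCS.le ?_ (by positivity) ?_ ?_
  · intro x
    have h1 := u2 ((1 + c.Bop μ hμ) x)
    have h2 := c.W_norm μ hμ b0 hb0 hb ((1 + c.Bop μ hμ) x)
    have h3 : (1 - c.Wop μ hμ) ((1 + c.Bop μ hμ) x) = x :=
      congrArg (fun F : XX →L[ℂ] XX => F x) (c.WB μ hμ)
    rw [h3] at h2
    have h4 : (1 - (1 - b0/(2*R)))⁻¹ ≤ 2 * R1 * b0⁻¹ := by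
      rw [sub_sub_cancel, inv_div, div_eq_mul_inv]; gcongr
    refine h2.trans ?_
    have h5 : ‖(1 + c.Bop μ hμ) x‖ ≤ 2 * R1 * b0⁻¹ * ‖(1 - Q) ((1 + c.Bop μ hμ) x)‖ :=
      h1.trans (by gcongr)
    calc _ ≤ (1 + 2 * c.G * b0⁻¹) * (2 * R1 * b0⁻¹ * ‖(1 - Q) ((1 + c.Bop μ hμ) x)‖) := by gcongr
      _ = _ := by unfold CS; show _ = _ * ‖(1 - Q) ((1 + c.Bop μ hμ) x)‖; ring
  · intro x
    have hVB : c.mx R e μ * c.Bop μ hμ x = (1 + (e:ℂ)) • c.Bop μ hμ x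
        + (Complex.I / R) • (c.U1 * opJ x) := by
      unfold mx
      rw [add_mul, smul_mul_assoc, smul_mul_assoc, one_mul, Bop_apply, ← mul_assoc (c.Nx μ), c.NM, one_mul]
    have key : c.Aop a ha R e μ x - ((1 - Q) * (1 + c.Bop μ hμ)) x
        = (Pop a ha (c.Bop μ hμ x) - c.Bop μ hμ x + xext (c.Bop μ hμ x) 0 • ea a ha)
          + (e:ℂ) • Pop a ha (c.Bop μ hμ x) := by
      have hz : xext (c.Bop μ hμ x) 0 = 0 := by
        rw [Bop_apply, xext_mul, xext_mul, J_zero]; simp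
      rw [hz, zero_smul, add_zero]
      rw [Aop_apply]
      show _ - ((x + c.Bop μ hμ x) - Pop a ha (c.mx R e μ * (x + c.Bop μ hμ x))) = _
      rw [mul_add, map_add, hVB, map_add, map_smul, map_smul, add_smul, one_smul]
      abel
    rw [key]
    have h1 := Pop_DD a ha (c.dB μ hμ x)
    have h2 := c.dB_norm μ hμ b0 hb0 hb x
    have h3 := (Pop_norm a ha (c.Bop μ hμ x)).trans (c.B_norm μ hμ b0 hb0 hb x)
    refine (norm_add_le _ _).trans ?_
    rw [norm_smul, Complex.norm_real, Real.norm_of_nonneg he]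
    calc _ ≤ 2 / a * ((2 * b0⁻¹^2 * c.G^2 + 3 * b0⁻¹ * c.G) * ‖x‖) + 1 / a * (2 * c.G * b0⁻¹ * ‖x‖) := by
          refine add_le_add (h1.trans ?_) ?_ <;> gcongr
      _ = _ := by unfold Ce; ring
  · rw [← mul_div_assoc, div_le_iff₀ ha]; linarith

/-! ### Approximate solution -/

def v0 (μ : ℂ) (h : 0 < μ.im) : XX := (1 - c.Wop μ h) (c.Mx μ h * c.ff)

lemma v0_eq (μ h) : c.v0 μ h = c.Mx μ h * c.ff - c.U1 * opJ (c.Mx μ h * (c.Mx μ h * c.ff)) := rfl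

lemma v0_sol (μ h) : c.Nx μ * c.v0 μ h + c.U1 * opJ (c.v0 μ h) = c.ff := by
  have h1 : (1 + c.Bop μ h) (c.v0 μ h) = c.Mx μ h * c.ff :=
    congrArg (fun F : XX →L[ℂ] XX => F (c.Mx μ h * c.ff)) (c.BW μ h)
  have h2 : c.v0 μ h + c.Mx μ h * (c.U1 * opJ (c.v0 μ h)) = c.Mx μ h * c.ff := h1
  have h3 := c.NM μ h
  linear_combination c.Nx μ * h2 + (c.ff - c.U1 * opJ (c.v0 μ h)) * h3

lemma J_v0 (μ h) : opJ (c.v0 μ h) = c.Nx μ * opJ (c.Mx μ h * (c.Mx μ h * c.ff)) := by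
  rw [v0_eq, map_sub, J_id1, sub_sub_cancel]

lemma v0_zero (μ h) : xext (c.v0 μ h) 0 = 1 / μ := by
  rw [v0_eq, xext_sub, xext_mul, xext_mul, J_zero, c.ff_zero, c.Mx_apply _ _ _ le_rfl, c.u_zero]; simp

lemma dv0 (μ h) : DD (c.v0 μ h) (c.Mx μ h * c.Mx μ h * Eh * c.U1 * c.ff + c.Mx μ h * c.ffd
    - (c.U1d * opJ (c.Mx μ h * (c.Mx μ h * c.ff)) + c.U1 * (Eh * (c.Mx μ h * (c.Mx μ h * c.ff))))) :=
  ((c.dM μ h).mul c.dff).sub (c.dU1.mul (DD_J _))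

def Cv (b0 : ℝ) : ℝ := 2 * (b0⁻¹^2 * c.G^2 + b0⁻¹ * c.G + 3 * c.G^2 * b0⁻¹^2)
  + (b0⁻¹ * c.G + 2 * c.G^2 * b0⁻¹^2)

lemma A_v0 (a : ℝ) (ha : 0 < a) (R e : ℝ) (μ : ℂ) (h) (b0 : ℝ) (hb0 : 0 < b0) (hb : b0 ≤ μ.im)
    (he : 0 ≤ e) (hea : e ≤ 1 / a) :
    ‖c.Aop a ha R e μ (c.v0 μ h) - (- ((Complex.I / R) • Pop a ha c.ff) + (1/μ) • ea a ha)‖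
      ≤ c.Cv b0 / a := by
  have hG := c.G_pos
  have hM := c.Mx_norm μ h b0 hb0 hb
  have hMf := nmul hM (nmul hM c.bff)
  have hJ : ‖opJ (c.Mx μ h * (c.Mx μ h * c.ff))‖ ≤ 2 * (b0⁻¹ * (b0⁻¹ * c.G)) :=
    (opJ_norm _).trans (by gcongr)
  have h1 := Pop_DD a ha (c.dv0 μ h)
  have h2 := (norm_sub_le _ _).trans (add_le_add ((norm_add_le _ _).trans (add_le_add
    (nmul (nmul (nmul (nmul hM hM) Eh_norm) c.bU1) c.bff) (nmul hM c.bffd)))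
    ((norm_add_le _ _).trans (add_le_add (nmul c.bU1d hJ) (nmul c.bU1 (nmul Eh_norm hMf)))))
  have h3 := (Pop_norm a ha (c.v0 μ h)).trans ((norm_sub_le _ _).trans (add_le_add (nmul hM c.bff)
    (nmul c.bU1 hJ)))
  have key : c.Aop a ha R e μ (c.v0 μ h) - (- ((Complex.I / R) • Pop a ha c.ff) + (1/μ) • ea a ha)
      = -(Pop a ha (c.v0 μ h) - c.v0 μ h + xext (c.v0 μ h) 0 • ea a ha) - (e:ℂ) • Pop a ha (c.v0 μ h) := by
    rw [Aop_apply, v0_zero]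
    conv_lhs => rw [← c.v0_sol μ h]
    unfold mx
    rw [add_mul, smul_mul_assoc, smul_mul_assoc, one_mul]
    simp only [map_add, map_smul, add_smul, one_smul, smul_add]
    abel
  rw [key]
  refine (norm_sub_le _ _).trans ?_
  rw [norm_neg, norm_smul, Complex.norm_real, Real.norm_of_nonneg he]
  refine (add_le_add (h1.trans (mul_le_mul_of_nonneg_left h2 (by positivity)))
    (mul_le_mul hea h3 (norm_nonneg _) (by positivity))).trans (le_of_eq ?_)
  unfold Cv; ring

lemma A_c (a : ℝ) (ha : 0 < a) (R e : ℝ) (hR : 1 ≤ R) (μ : ℂ) (l : ℂ) (hl : 0 < l.re)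
    (hm : (a + 1 + l) * (a - l) = (1 + e + Complex.I / R * μ) * (a * (a + 1))) :
    ‖c.Aop a ha R e μ (expX l hl.le) - ea a ha‖ ≤ 2 * c.G / l.re := by
  have hG := c.G_pos
  have h1 := Pop_expX a ha l hl.le _ hm
  have key : c.Aop a ha R e μ (expX l hl.le) - ea a ha
      = (Complex.I / R) • (Pop a ha (c.UX * expX l hl.le) - Pop a ha (c.U1 * opJ (expX l hl.le))) := by
    rw [Aop_apply]
    have : c.mx R e μ * expX l hl.le = (1 + (e:ℂ) + Complex.I / R * μ) • expX l hl.le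
        - (Complex.I / R) • (c.UX * expX l hl.le) := by
      unfold mx Nx
      rw [add_mul, smul_mul_assoc, smul_mul_assoc, one_mul, sub_mul, smul_mul_assoc, one_mul,
        smul_sub, smul_smul, add_smul (1 + (e:ℂ))]
      abel
    rw [this, map_sub, h1, map_smul, smul_sub]
    abel
  rw [key, norm_smul]
  have hn : ‖Complex.I / (R:ℂ)‖ ≤ 1 := by
    rw [norm_div, Complex.norm_I, Complex.norm_real, Real.norm_of_nonneg (by linarith)]
    rw [div_le_one (by linarith)]; exact hR
  have h2 : ‖c.UX * expX l hl.le‖ ≤ c.G / l.re := by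
    refine xx_norm_le (by positivity) fun y hy => ?_
    rw [xext_mul, norm_mul, norm_xext_expX _ _ _ hy, c.hUX _ hy, Complex.norm_real,
      Real.norm_of_nonneg (c.u_nonneg y hy)]
    have h3 := c.u_lip y hy
    have h4 : l.re * y * Real.exp (-l.re * y) ≤ 1 := by
      have := Real.add_one_le_exp (l.re * y)
      rw [neg_mul, Real.exp_neg, ← div_eq_mul_inv, div_le_one (Real.exp_pos _)]; linarith
    rw [le_div_iff₀ hl]
    calc _ ≤ c.G * y * Real.exp (-l.re * y) * l.re := by gcongr
      _ = c.G * (l.re * y * Real.exp (-l.re * y)) := by ring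
      _ ≤ c.G * 1 := by gcongr
      _ = _ := mul_one _
  have h3 : ‖c.U1 * opJ (expX l hl.le)‖ ≤ c.G / l.re :=
    (nmul c.bU1 (norm_J_expX l hl)).trans (le_of_eq (by ring))
  have h4 := (norm_sub_le _ _).trans (add_le_add ((Pop_norm a ha _).trans h2) ((Pop_norm a ha _).trans h3))
  calc _ ≤ 1 * (c.G / l.re + c.G / l.re) := by gcongr
    _ = _ := by ring

end Coef

end

section

lemma exists_sqrt_re (z : ℂ) (b0 : ℝ) (hz : b0 ≤ z.re) : ∃ w : ℂ, w^2 = z ∧ Real.sqrt b0 ≤ w.re := by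
  obtain ⟨w, hw⟩ := IsAlgClosed.exists_pow_nat_eq z (n := 2) (by norm_num)
  have key : ∀ w : ℂ, w^2 = z → 0 ≤ w.re → Real.sqrt b0 ≤ w.re := by
    intro w hw h0
    rw [Real.sqrt_le_left h0]
    have := congrArg Complex.re hw
    rw [pow_two, Complex.mul_re] at this
    nlinarith [sq_nonneg w.im]
  rcases le_total 0 w.re with h | h
  · exact ⟨w, hw, key w hw h⟩
  · exact ⟨-w, by rw [neg_sq, hw], key (-w) (by rw [neg_sq, hw]) (by simpa using h)⟩

lemma diff_ring_inv {A : Type*} [NormedRing A] [NormedAlgebra ℂ A] [HasSummableGeomSeries A]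
    (f : ℂ → A) (z : ℂ) (hf : DifferentiableAt ℂ f z) (hu : IsUnit (f z)) :
    DifferentiableAt ℂ (fun w => Ring.inverse (f w)) z :=
  (differentiableAt_inverse (𝕜 := ℂ) hu).comp z hf

namespace Coef
variable (c : Coef)

def rhs (a : ℝ) (ha : 0 < a) (R : ℝ) : XX := -((Complex.I / R) • Pop a ha c.ff) + ea a ha

def xsol (a : ℝ) (ha : 0 < a) (R e : ℝ) (μ : ℂ) : XX := Ring.inverse (c.Aop a ha R e μ) (c.rhs a ha R)

lemma A_xsol (a ha R e μ) (h : IsUnit (c.Aop a ha R e μ)) :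
    c.Aop a ha R e μ (c.xsol a ha R e μ) = c.rhs a ha R :=
  congrArg (fun F : XX →L[ℂ] XX => F (c.rhs a ha R)) (Ring.mul_inverse_cancel _ h)

lemma diff_xsol (a ha R e μ) (h : IsUnit (c.Aop a ha R e μ)) :
    DifferentiableAt ℂ (c.xsol a ha R e) μ := by
  have h1 : DifferentiableAt ℂ (fun μ => c.mx R e μ) μ := by
    unfold mx Nx; fun_prop
  have h4 : DifferentiableAt ℂ (fun μ => ContinuousLinearMap.mul ℂ XX (c.mx R e μ)) μ :=
    (ContinuousLinearMap.mul ℂ XX).differentiableAt.comp μ h1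
  have h5 : DifferentiableAt ℂ (fun μ => (Pop a ha).comp (ContinuousLinearMap.mul ℂ XX (c.mx R e μ))) μ :=
    DifferentiableAt.clm_comp (differentiableAt_const _) h4
  have h2 : DifferentiableAt ℂ (fun μ => c.Aop a ha R e μ) μ := by
    unfold Aop
    exact (h5.const_sub (1 : XX →L[ℂ] XX)).sub_const _
  have h3 : DifferentiableAt ℂ (fun μ => Ring.inverse (c.Aop a ha R e μ)) μ :=
    diff_ring_inv (A := XX →L[ℂ] XX) _ μ h2 h
  exact h3.clm_apply (differentiableAt_const _)

lemma xsol_ode (a : ℝ) (ha : 0 < a) (R e k : ℝ) (hk : 0 < k) (hR : R = a * (a+1) / k)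
    (he : e = 1 / (4 * (a * (a+1)))) (μ : ℂ) (x : XX)
    (hx : c.Aop a ha R e μ x = c.rhs a ha R) :
    ∃ x1 x2 : XX, DD x x1 ∧ DD x1 x2 ∧ xext x 0 = 1 ∧
      c.Nx μ * x + c.U1 * opJ x - (Complex.I / k) • (x2 - x1 + (1/4 : ℂ) • x) = c.ff := by
  have hb : 0 < a + 1 := by linarith
  set h := c.mx R e μ * x + (Complex.I / R) • (c.U1 * opJ x) - (Complex.I / R) • c.ff with hh
  set u := opQm (a+1) hb h with hu
  have e1 : opQp a ha u = x - ea a ha := by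
    rw [Aop_apply] at hx
    unfold rhs at hx
    have : Pop a ha h = x - ea a ha := by
      rw [hh, map_sub, map_add, map_smul, map_smul]
      have h2 : Pop a ha (c.mx R e μ * x) = x - (Complex.I / R) • Pop a ha (c.U1 * opJ x)
          - (-((Complex.I / R) • Pop a ha c.ff) + ea a ha) := by rw [← hx]; abel
      rw [h2]; abel
    exact this
  have e2 : x = opQp a ha u + ea a ha := by rw [e1]; abel
  have d1 : DD x ((a:ℂ) • (u - x)) := by
    have := ((DD_Qp a ha u).add (DD_ea a ha))
    rw [← e2, e1] at this
    refine this.congr ?_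
    rw [neg_smul, ← sub_eq_add_neg, ← smul_sub]
    congr 1; abel
  have d2 : DD ((a:ℂ) • (u - x)) ((a:ℂ) • ((((a+1 : ℝ)):ℂ) • (u - h) - (a:ℂ) • (u - x))) :=
    ((DD_Qm (a+1) hb h).sub d1).smul _
  refine ⟨_, _, d1, d2, ?_, ?_⟩
  · rw [e2, xext_add, Qp_zero, xext_ea _ _ _ le_rfl, wexp_zero, zero_add]
  · have ha' : (a:ℂ) ≠ 0 := by exact_mod_cast ha.ne'
    have hb' : ((a:ℂ)+1) ≠ 0 := by exact_mod_cast hb.ne'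
    have hk' : (k:ℂ) ≠ 0 := by exact_mod_cast hk.ne'
    refine xx_ext fun y hy => ?_
    have hhy : xext h y = ((1 + e) + Complex.I / R * xext (c.Nx μ) y) * xext x y
        + Complex.I / R * (xext c.U1 y * xext (opJ x) y) - Complex.I / R * xext c.ff y := by
      rw [hh]; unfold mx
      simp only [xext_sub, xext_add, xext_mul, xext_smul, xext_one, mul_one]
    have hRc : (R:ℂ) = a * (a+1) / k := by rw [hR]; push_cast; rfl
    have hec : (e:ℂ) = 1 / (4 * (a * (a+1))) := by rw [he]; push_cast; rfl
    rw [hRc, hec] at hhy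
    simp only [xext_sub, xext_add, xext_mul, xext_smul]
    rw [hhy]
    push_cast
    field_simp
    ring_nf
    simp only [Complex.I_sq]
    ring

lemma inv_mu (μ : ℂ) (b0 : ℝ) (hb0 : 0 < b0) (hb : b0 ≤ μ.im) : ‖1 - 1/μ‖ ≤ 1 + b0⁻¹ := by
  refine (norm_sub_le _ _).trans ?_
  have := den_bound μ b0 hb0 hb 0
  simp only [Complex.ofReal_zero, sub_zero] at this
  rw [norm_one, one_div]; linarith

set_option maxHeartbeats 1600000 in
theorem visc (b0 C0 : ℝ) (hb0 : 0 < b0) (hC0 : 0 ≤ C0) : ∃ K : ℝ, 1 ≤ K ∧ ∀ k : ℝ, K ≤ k →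
    ∃ x : ℂ → XX, ∀ μ : ℂ, ∀ h : 0 < μ.im, b0 ≤ μ.im → ‖μ‖ ≤ C0 → DifferentiableAt ℂ x μ ∧
      ‖opEll (x μ) - opEll (c.v0 μ h)‖ ≤ 1 ∧
      ∃ x1 x2 : XX, DD (x μ) x1 ∧ DD x1 x2 ∧ xext (x μ) 0 = 1 ∧
      c.Nx μ * x μ + c.U1 * opJ (x μ) - (Complex.I / k) • (x2 - x1 + (1/4 : ℂ) • x μ) = c.ff := by
  have hG := c.G_pos
  have hi : 0 < b0⁻¹ := by positivity
  set ρ : ℝ := 5 * (C0+1)^2 * b0⁻¹ + C0 + 1 with hρ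
  have hρ1 : 1 ≤ ρ := by
    have : 0 ≤ 5 * (C0+1)^2 * b0⁻¹ := by positivity
    linarith
  have hρC : C0 ≤ ρ := by
    have : 0 ≤ 5 * (C0+1)^2 * b0⁻¹ := by positivity
    linarith
  have hρb : 5 * (C0+1)^2 ≤ b0 * ρ := by
    have : b0 * ρ = 5 * (C0+1)^2 + b0 * (C0 + 1) := by rw [hρ]; field_simp; ring
    rw [this]; have : 0 ≤ b0 * (C0+1) := by positivity
    linarith
  set R1 : ℝ := ρ^2 + ρ with hR1
  have hR10 : 0 < R1 := by positivity
  have hCS : 0 < c.CS b0 R1 := by unfold CS; positivity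
  have hCe : 0 < c.Ce b0 := by unfold Ce; positivity
  have hCv : 0 < c.Cv b0 := by unfold Cv; positivity
  set σ : ℝ := Real.sqrt b0 / (2 * ρ) with hσ
  have hσ0 : 0 < σ := by have := Real.sqrt_pos.2 hb0; positivity
  set Ct : ℝ := 2 * (2 * c.CS b0 R1 * (c.Cv b0 + (1 + b0⁻¹) * (2 * c.G / σ))) + (1 + b0⁻¹) / σ with hCt
  have hCt0 : 0 < Ct := by positivity
  refine ⟨1 + 2 * b0⁻¹ + (2 * c.CS b0 R1 * c.Ce b0)^2 + Ct^2, ?_, ?_⟩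
  · have : 0 ≤ 2 * b0⁻¹ + (2 * c.CS b0 R1 * c.Ce b0)^2 + Ct^2 := by positivity
    linarith
  intro k hK
  have hq1 := sq_nonneg (2 * c.CS b0 R1 * c.Ce b0)
  have hq2 := sq_nonneg Ct
  have hk1 : 1 ≤ k := by linarith
  have hk0 : 0 < k := by linarith
  have hk2 : 2 * b0⁻¹ ≤ k := by linarith
  set s := Real.sqrt k with hs
  have hss : s * s = k := Real.mul_self_sqrt hk0.le
  have hs1 : 1 ≤ s := Real.one_le_sqrt.2 hk1
  have hs3 : 2 * c.CS b0 R1 * c.Ce b0 ≤ s := Real.le_sqrt_of_sq_le (by linarith)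
  have hs4 : Ct ≤ s := Real.le_sqrt_of_sq_le (by linarith)
  set a := ρ * s with ha_def
  have hsa : s ≤ a := le_mul_of_one_le_left (by linarith) hρ1
  have ha : 0 < a := by linarith
  set R := a * (a+1) / k with hR
  set e := 1 / (4 * (a * (a+1))) with he
  have hRe : R = ρ^2 + ρ / s := by
    rw [hR, ha_def, ← hss]; field_simp
  have hRl : ρ ≤ R := by
    rw [hRe]; have : 0 ≤ ρ / s := by positivity
    nlinarith
  have hRu : R ≤ R1 := by
    rw [hRe, hR1]; have : ρ / s ≤ ρ := div_le_self (by linarith) hs1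
    linarith
  have he0 : 0 ≤ e := by positivity
  have hea : e ≤ 1 / a := by
    rw [he]; refine one_div_le_one_div_of_le ha ?_
    have h0 := mul_pos ha ha
    rw [mul_add, mul_one]; linarith
  have he' : 8 * R * e ≤ b0 := by
    have : 8 * R * e = 2 / k := by rw [hR, he]; field_simp; norm_num
    rw [this, div_le_iff₀ hk0]
    calc 2 = b0 * (2 * b0⁻¹) := by field_simp
      _ ≤ b0 * k := by gcongr
  refine ⟨c.xsol a ha R e, fun μ hμ hb hC => ?_⟩
  obtain ⟨hu, hlow⟩ := c.A_unit a ha R e μ b0 C0 R1 hb0 hb hC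
    (hρb.trans (by gcongr)) (hρC.trans hRl) he0 he' hRu hea (hs3.trans hsa)
  have hAx := c.A_xsol a ha R e μ hu
  refine ⟨c.diff_xsol a ha R e μ hu, ?_, c.xsol_ode a ha R e k hk0 hR he μ _ hAx⟩
  obtain ⟨w, hw, hwre⟩ := exists_sqrt_re (-Complex.I * μ) b0 (by simpa using hb)
  set l : ℂ := (s:ℂ) * w - 1/2 with hl
  have hsb : 1 ≤ s * Real.sqrt b0 := by
    rw [hs, ← Real.sqrt_mul hk0.le]
    refine Real.one_le_sqrt.2 ?_
    calc (1:ℝ) = b0⁻¹ * b0 := by field_simp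
      _ ≤ k * b0 := by gcongr; linarith
  have hlre : l.re = s * w.re - 1/2 := by rw [hl]; simp
  have hlσ : σ * a ≤ l.re := by
    have h1 : s * Real.sqrt b0 ≤ s * w.re := by gcongr
    have h2 : σ * a = s * Real.sqrt b0 / 2 := by rw [hσ, ha_def]; field_simp
    rw [hlre, h2]; linarith
  have hl0 : 0 < l.re := lt_of_lt_of_le (by positivity) hlσ
  have hm : (a + 1 + l) * (a - l) = (1 + e + Complex.I / R * μ) * (a * (a + 1)) := by
    have ha' : (a:ℂ) ≠ 0 := by exact_mod_cast ha.ne'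
    have hb' : ((a:ℂ)+1) ≠ 0 := by exact_mod_cast (by linarith : a + 1 ≠ 0)
    have hk' : (k:ℂ) ≠ 0 := by exact_mod_cast hk0.ne'
    have hRc : (R:ℂ) = a * (a+1) / k := by rw [hR]; push_cast; rfl
    have hec : (e:ℂ) = 1 / (4 * (a * (a+1))) := by rw [he]; push_cast; rfl
    have hsc : (s:ℂ) * s = k := by rw [← hss]; push_cast; rfl
    rw [hRc, hec, hl]
    have e1 : (1 + 1 / (4 * ((a:ℂ) * (a+1))) + Complex.I / (a * (a+1) / k) * μ) * (a * (a+1))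
      = a * (a+1) + 1/4 + Complex.I * k * μ := by field_simp
    rw [e1]
    linear_combination (-(s:ℂ)*s) * hw + (Complex.I * μ) * hsc
  set cc := expX l hl0.le with hcc
  have h1 := c.A_v0 a ha R e μ hμ b0 hb0 hb he0 hea
  have h2 := c.A_c a ha R e (hρ1.trans hRl) μ l hl0 hm
  have h3 := inv_mu μ b0 hb0 hb
  have hinv : 1 / l.re ≤ 1 / (σ * a) := one_div_le_one_div_of_le (by positivity) hlσ
  have h2' : ‖c.Aop a ha R e μ cc - ea a ha‖ ≤ 2 * c.G / σ / a := by
    refine h2.trans ?_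
    calc 2 * c.G / l.re = 2 * c.G * (1 / l.re) := by ring
      _ ≤ 2 * c.G * (1 / (σ * a)) := by gcongr
      _ = _ := by field_simp
  set app := c.v0 μ hμ + (1 - 1/μ) • cc with happ
  have h4 : ‖c.Aop a ha R e μ (app - c.xsol a ha R e μ)‖
      ≤ c.Cv b0 / a + (1 + b0⁻¹) * (2 * c.G / σ / a) := by
    have : c.Aop a ha R e μ (app - c.xsol a ha R e μ)
        = (c.Aop a ha R e μ (c.v0 μ hμ) - (- ((Complex.I / R) • Pop a ha c.ff) + (1/μ) • ea a ha))
          + (1 - 1/μ) • (c.Aop a ha R e μ cc - ea a ha) := by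
      rw [map_sub, hAx, happ, map_add, map_smul]
      unfold rhs
      rw [smul_sub, sub_smul 1 (1/μ) (ea a ha), one_smul]
      abel
    rw [this]
    refine (norm_add_le _ _).trans (add_le_add h1 ?_)
    rw [norm_smul]
    exact mul_le_mul h3 h2' (norm_nonneg _) (by positivity)
  have h5 := (hlow (app - c.xsol a ha R e μ)).trans
    (mul_le_mul_of_nonneg_left h4 (by positivity))
  have h6 : opEll (c.xsol a ha R e μ) - opEll (c.v0 μ hμ)
      = (1 - 1/μ) • opEll cc - opEll (app - c.xsol a ha R e μ) := by
    rw [map_sub, happ, map_add, map_smul]; abel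
  rw [h6]
  have h7 := norm_ell_expX l hl0
  have h8 : ‖(1 - 1/μ) • opEll cc‖ ≤ (1 + b0⁻¹) * (1 / (σ * a)) := by
    rw [norm_smul]
    exact mul_le_mul h3 (h7.trans hinv) (norm_nonneg _) (by positivity)
  have h9 := opEll_norm (app - c.xsol a ha R e μ)
  refine (norm_sub_le _ _).trans ?_
  have h10 : (1 + b0⁻¹) * (1 / (σ * a)) + 2 * (2 * c.CS b0 R1 * (c.Cv b0 / a + (1 + b0⁻¹) * (2 * c.G / σ / a)))
      = Ct / a := by rw [hCt]; field_simp; ring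
  have h11 : Ct / a ≤ 1 := by rw [div_le_one ha]; linarith
  linarith

end Coef

end

section

/-! ### Smooth extension of solutions of linear ODEs -/

lemma glue_deriv {g f g' f' : ℝ → ℂ} {δ : ℝ} (hδ : 0 < δ)
    (hg : ∀ y, -δ < y → y ≤ 0 → HasDerivAt g (g' y) y) (hf : ∀ y, 0 < y → HasDerivAt f (f' y) y)
    (hfc : Continuous f) (hfc' : ContinuousWithinAt f' (Ici 0) 0) (h0 : g 0 = f 0) (h0' : g' 0 = f' 0) :
    ∀ y, -δ < y → HasDerivAt (fun y => if y < 0 then g y else f y) (if y < 0 then g' y else f' y) y := by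
  intro y hy
  rcases lt_trichotomy y 0 with h | h | h
  · rw [if_pos h]
    refine (hg y hy h.le).congr_of_eventuallyEq ?_
    filter_upwards [gt_mem_nhds h] with z hz
    exact if_pos hz
  · subst h
    rw [if_neg (lt_irrefl _)]
    have hl : HasDerivWithinAt (fun y => if y < 0 then g y else f y) (f' 0) (Iic 0) 0 := by
      rw [← h0']
      refine (hg 0 hy le_rfl).hasDerivWithinAt.congr ?_ ?_
      · intro z hz
        rcases (show z ≤ 0 from hz).lt_or_eq with h | h
        · exact if_pos h
        · rw [h]; simp [h0]
      · simp [h0]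
    have hr0 : HasDerivWithinAt f (f' 0) (Ici 0) 0 := by
      refine hasDerivWithinAt_Ici_of_tendsto_deriv (s := Ioi 0)
        (fun z hz => (hf z hz).differentiableAt.differentiableWithinAt) hfc.continuousWithinAt
        self_mem_nhdsWithin ?_
      have : Tendsto f' (nhdsWithin 0 (Ioi 0)) (nhds (f' 0)) :=
        hfc'.mono_left (nhdsWithin_mono _ Ioi_subset_Ici_self)
      refine this.congr' ?_
      filter_upwards [self_mem_nhdsWithin] with z hz using (hf z hz).deriv.symm
    have hr : HasDerivWithinAt (fun y => if y < 0 then g y else f y) (f' 0) (Ici 0) 0 := by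
      refine hr0.congr ?_ ?_
      · intro z hz
        exact if_neg (not_lt.2 hz)
      · simp
    have := hl.union hr
    rwa [Iic_union_Ici, hasDerivWithinAt_univ] at this
  · rw [if_neg (not_lt.2 h.le)]
    refine (hf y h).congr_of_eventuallyEq ?_
    filter_upwards [lt_mem_nhds h] with z hz
    exact if_neg (not_lt.2 (le_of_lt hz))

lemma hasDerivAt_fst_of {E F : Type*} [NormedAddCommGroup E] [NormedSpace ℝ E]
    [NormedAddCommGroup F] [NormedSpace ℝ F] {f : ℝ → E × F} {f' : E × F} {y : ℝ}
    (h : HasDerivAt f f' y) : HasDerivAt (fun y => (f y).1) f'.1 y :=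
  (ContinuousLinearMap.fst ℝ E F).hasFDerivAt.comp_hasDerivAt y h

lemma hasDerivAt_snd_of {E F : Type*} [NormedAddCommGroup E] [NormedSpace ℝ E]
    [NormedAddCommGroup F] [NormedSpace ℝ F] {f : ℝ → E × F} {f' : E × F} {y : ℝ}
    (h : HasDerivAt f f' y) : HasDerivAt (fun y => (f y).2) f'.2 y :=
  (ContinuousLinearMap.snd ℝ E F).hasFDerivAt.comp_hasDerivAt y h

lemma local_sol (p q r : ℝ → ℂ) (hp : ContDiff ℝ (⊤ : ℕ∞) p) (hq : ContDiff ℝ (⊤ : ℕ∞) q)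
    (hr : ContDiff ℝ (⊤ : ℕ∞) r) (A B C : ℂ) :
    ∃ g0 g1 g2 : ℝ → ℂ, g0 0 = A ∧ g1 0 = B ∧ g2 0 = C ∧ ∃ δ > 0, ∀ y, -δ < y → y ≤ 0 →
      HasDerivAt g0 (g1 y) y ∧ HasDerivAt g1 (g2 y) y ∧
      HasDerivAt g2 (p y * g1 y + q y * g0 y + r y) y := by
  set V : ℝ × ℂ × ℂ × ℂ → ℝ × ℂ × ℂ × ℂ := fun w =>
    (1, w.2.2.1, w.2.2.2, p w.1 * w.2.2.1 + q w.1 * w.2.1 + r w.1) with hV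
  have hc : ContDiff ℝ (⊤ : ℕ∞) V := by
    rw [hV]
    have h1 : ContDiff ℝ (⊤ : ℕ∞) (fun w : ℝ × ℂ × ℂ × ℂ => p w.1) := hp.comp contDiff_fst
    have h2 : ContDiff ℝ (⊤ : ℕ∞) (fun w : ℝ × ℂ × ℂ × ℂ => q w.1) := hq.comp contDiff_fst
    have h3 : ContDiff ℝ (⊤ : ℕ∞) (fun w : ℝ × ℂ × ℂ × ℂ => r w.1) := hr.comp contDiff_fst
    fun_prop
  obtain ⟨α, hα0, δ, hδ, hα⟩ :=
    (hc.contDiffAt.of_le (by exact_mod_cast le_top) :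
      ContDiffAt ℝ 1 V (0, A, B, C)).exists_forall_mem_closedBall_exists_eq_forall_mem_Ioo_hasDerivAt₀ 0
  rw [zero_sub, zero_add] at hα
  have hτ : ∀ y ∈ Ioo (-δ) δ, (α y).1 = y := by
    have hd : ∀ y ∈ Ioo (-δ) δ, HasDerivAt (fun y => (α y).1 - y) 0 y := fun y hy => by
      have h1 : HasDerivAt (fun y => (α y).1) 1 y := hasDerivAt_fst_of (hα y hy)
      exact (h1.sub (hasDerivAt_id y)).congr_deriv (sub_self _)
    intro y hy
    have h0 : (0:ℝ) ∈ Ioo (-δ) δ := ⟨by linarith, hδ⟩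
    have := isOpen_Ioo.is_const_of_deriv_eq_zero isPreconnected_Ioo
      (fun z hz => (hd z hz).differentiableAt.differentiableWithinAt)
      (fun z hz => (hd z hz).deriv) hy h0
    simp only [hα0] at this
    linarith
  refine ⟨fun y => (α y).2.1, fun y => (α y).2.2.1, fun y => (α y).2.2.2, by simp [hα0], by simp [hα0],
    by simp [hα0], δ, hδ, fun y hy hy0 => ?_⟩
  have hm : y ∈ Ioo (-δ) δ := ⟨hy, by linarith⟩
  have h := hα y hm
  have ht := hτ y hm
  refine ⟨hasDerivAt_fst_of (hasDerivAt_snd_of h),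
    hasDerivAt_fst_of (hasDerivAt_snd_of (hasDerivAt_snd_of h)), ?_⟩
  have h2 := hasDerivAt_snd_of (hasDerivAt_snd_of (hasDerivAt_snd_of h))
  simp only [hV, ht] at h2
  exact h2

lemma smooth_boot (p q r h0 h1 h2 : ℝ → ℂ) (hp : ContDiff ℝ (⊤ : ℕ∞) p) (hq : ContDiff ℝ (⊤ : ℕ∞) q)
    (hr : ContDiff ℝ (⊤ : ℕ∞) r) (δ : ℝ) (H0 : ∀ y, -δ < y → HasDerivAt h0 (h1 y) y)
    (H1 : ∀ y, -δ < y → HasDerivAt h1 (h2 y) y)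
    (H2 : ∀ y, -δ < y → HasDerivAt h2 (p y * h1 y + q y * h0 y + r y) y) :
    ContDiffOn ℝ (⊤ : ℕ∞) h0 (Ioi (-δ)) := by
  have key : ∀ n : ℕ, ContDiffOn ℝ n h0 (Ioi (-δ)) ∧ ContDiffOn ℝ n h1 (Ioi (-δ)) ∧
      ContDiffOn ℝ n h2 (Ioi (-δ)) := by
    have step : ∀ (n : ℕ) (f f' : ℝ → ℂ), (∀ y, -δ < y → HasDerivAt f (f' y) y) →
        ContDiffOn ℝ n f' (Ioi (-δ)) → ContDiffOn ℝ (n+1 : ℕ) f (Ioi (-δ)) := by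
      intro n f f' hf hf'
      push_cast
      rw [contDiffOn_succ_iff_deriv_of_isOpen isOpen_Ioi]
      refine ⟨fun z hz => (hf z hz).differentiableAt.differentiableWithinAt, fun h => by simp at h, ?_⟩
      exact hf'.congr fun z hz => (hf z hz).deriv
    intro n
    induction n with
    | zero =>
      simp only [Nat.cast_zero, contDiffOn_zero]
      exact ⟨fun z hz => (H0 z hz).continuousAt.continuousWithinAt,
        fun z hz => (H1 z hz).continuousAt.continuousWithinAt,
        fun z hz => (H2 z hz).continuousAt.continuousWithinAt⟩
    | succ n ih =>
      obtain ⟨i0, i1, i2⟩ := ih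
      refine ⟨step n _ _ H0 i1, step n _ _ H1 i2, step n _ _ H2 ?_⟩
      have hn : ((n : ℕ) : WithTop ℕ∞) ≤ ((⊤ : ℕ∞) : WithTop ℕ∞) := by exact_mod_cast le_top
      exact ((((hp.of_le hn).contDiffOn).mul i1).add (((hq.of_le hn).contDiffOn).mul i0)).add
        ((hr.of_le hn).contDiffOn)
  exact contDiffOn_infty.2 fun n => (key n).1

lemma smooth_extend (p q r f0 f1 f2 : ℝ → ℂ) (hp : ContDiff ℝ (⊤ : ℕ∞) p) (hq : ContDiff ℝ (⊤ : ℕ∞) q)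
    (hr : ContDiff ℝ (⊤ : ℕ∞) r) (c0 : Continuous f0) (c1 : Continuous f1) (c2 : Continuous f2)
    (H0 : ∀ y, 0 < y → HasDerivAt f0 (f1 y) y)
    (H1 : ∀ y, 0 < y → HasDerivAt f1 (f2 y) y)
    (H2 : ∀ y, 0 < y → HasDerivAt f2 (p y * f1 y + q y * f0 y + r y) y) :
    ∃ φ : ℝ → ℂ, ContDiff ℝ (⊤ : ℕ∞) φ ∧ ∀ y, 0 ≤ y → φ y = f0 y ∧ deriv φ y = f1 y ∧
      iteratedDeriv 3 φ y = p y * f1 y + q y * f0 y + r y := by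
  obtain ⟨g0, g1, g2, e0, e1, e2, δ, hδ, hg⟩ := local_sol p q r hp hq hr (f0 0) (f1 0) (f2 0)
  set h0 : ℝ → ℂ := fun y => if y < 0 then g0 y else f0 y with hh0
  set h1 : ℝ → ℂ := fun y => if y < 0 then g1 y else f1 y with hh1
  set h2 : ℝ → ℂ := fun y => if y < 0 then g2 y else f2 y with hh2
  have D0 : ∀ y, -δ < y → HasDerivAt h0 (h1 y) y :=
    glue_deriv hδ (fun y a b => (hg y a b).1) H0 c0 c1.continuousWithinAt e0 e1
  have D1 : ∀ y, -δ < y → HasDerivAt h1 (h2 y) y :=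
    glue_deriv hδ (fun y a b => (hg y a b).2.1) H1 c1 c2.continuousWithinAt e1 e2
  have D2 : ∀ y, -δ < y → HasDerivAt h2 (p y * h1 y + q y * h0 y + r y) y := by
    intro y hy
    have hc := hp.continuous
    have hc' := hq.continuous
    have hc'' := hr.continuous
    have := glue_deriv (g' := fun y => p y * g1 y + q y * g0 y + r y)
      (f' := fun y => p y * f1 y + q y * f0 y + r y) hδ (fun y a b => (hg y a b).2.2) H2 c2
      (Continuous.continuousWithinAt (by fun_prop)) e2 (by simp only [e0, e1]) y hy
    refine this.congr_deriv ?_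
    simp only [hh1, hh0]
    split_ifs <;> rfl
  have hs := smooth_boot p q r h0 h1 h2 hp hq hr δ D0 D1 D2
  set χ : ℝ → ℝ := fun y => Real.smoothTransition (3 / δ * (y + 2 * δ / 3)) with hχ
  have χs : ContDiff ℝ (⊤ : ℕ∞) χ := by
    rw [hχ]
    exact Real.smoothTransition.contDiff.comp (by fun_prop)
  have χ0 : ∀ y, y < -(2*δ/3) → χ y = 0 := fun y hy => by
    refine Real.smoothTransition.zero_of_nonpos ?_
    exact mul_nonpos_of_nonneg_of_nonpos (by positivity) (by linarith)
  have χ1 : ∀ y, -(δ/3) < y → χ y = 1 := fun y hy => by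
    refine Real.smoothTransition.one_of_one_le ?_
    rw [div_mul_eq_mul_div, le_div_iff₀ hδ]; linarith
  set φ : ℝ → ℂ := fun y => (χ y : ℂ) * h0 y with hφ
  have hφs : ContDiff ℝ (⊤ : ℕ∞) φ := by
    rw [contDiff_iff_contDiffAt]
    intro y
    rcases lt_or_ge y (-(2*δ/3)) with h | h
    · have : φ =ᶠ[nhds y] fun _ => 0 := by
        filter_upwards [gt_mem_nhds h] with z hz
        simp [hφ, χ0 z hz]
      exact contDiffAt_const.congr_of_eventuallyEq this
    · have hy : -δ < y := by linarith
      have h1 : ContDiffAt ℝ (⊤ : ℕ∞) h0 y := hs.contDiffAt (Ioi_mem_nhds hy)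
      have h2 : ContDiffAt ℝ (⊤ : ℕ∞) (fun y => (χ y : ℂ)) y :=
        (Complex.ofRealCLM.contDiff.comp χs).contDiffAt
      exact h2.mul h1
  have E0 : ∀ y, -(δ/3) < y → φ =ᶠ[nhds y] h0 := fun y hy => by
    filter_upwards [lt_mem_nhds hy] with z hz
    simp [hφ, χ1 z hz]
  have F1 : ∀ y, -(δ/3) < y → deriv φ y = h1 y := fun y hy => by
    rw [(E0 y hy).deriv_eq]; exact (D0 y (by linarith)).deriv
  have E1 : ∀ y, -(δ/3) < y → deriv φ =ᶠ[nhds y] h1 := fun y hy => by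
    filter_upwards [lt_mem_nhds hy] with z hz using F1 z hz
  have F2 : ∀ y, -(δ/3) < y → deriv (deriv φ) y = h2 y := fun y hy => by
    rw [(E1 y hy).deriv_eq]; exact (D1 y (by linarith)).deriv
  have E2 : ∀ y, -(δ/3) < y → deriv (deriv φ) =ᶠ[nhds y] h2 := fun y hy => by
    filter_upwards [lt_mem_nhds hy] with z hz using F2 z hz
  refine ⟨φ, hφs, fun y hy => ?_⟩
  have hy' : -(δ/3) < y := by linarith
  have n0 : h0 y = f0 y := if_neg (not_lt.2 hy)
  have n1 : h1 y = f1 y := if_neg (not_lt.2 hy)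
  refine ⟨(E0 y hy').eq_of_nhds.trans n0, (F1 y hy').trans n1, ?_⟩
  have : iteratedDeriv 3 φ = deriv (deriv (deriv φ)) := by
    simp [iteratedDeriv_succ, iteratedDeriv_zero]
  rw [this, (E2 y hy').deriv_eq, (D2 y (by linarith)).deriv, n0, n1]

end

section

/-! ### From a flow to the abstract coefficients -/

structure NiceFlow (U V W : ℝ → ℝ) (C : ℝ) : Prop where
  smooth : ContDiff ℝ (⊤ : ℕ∞) U
  dU : ∀ y, HasDerivAt U (V y) y
  dV : ∀ y, HasDerivAt V (W y) y
  cW : Continuous W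
  hC : 1 ≤ C
  nonneg : ∀ y, 0 ≤ y → 0 ≤ U y
  le_one : ∀ y, 0 ≤ y → U y ≤ 1
  zero : U 0 = 0
  b0 : ∀ y, 0 ≤ y → 1 - U y ≤ C * Real.exp (-y)
  b1 : ∀ y, 0 ≤ y → |V y| ≤ C * Real.exp (-y)
  b2 : ∀ y, 0 ≤ y → |W y| ≤ C * Real.exp (-y)

lemma exp_half_bound (y : ℝ) (hy : 0 ≤ y) (g : ℝ → ℝ) (M : ℝ) (hM : 0 ≤ M)
    (hg : |g y| ≤ M * (1 + y) * Real.exp (-y)) :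
    ‖((Real.exp (1/2*y) * g y : ℝ) : ℂ)‖ ≤ 3 * M := by
  rw [Complex.norm_real, Real.norm_eq_abs, abs_mul, abs_of_pos (Real.exp_pos _)]
  have h1 : Real.exp (-y) = Real.exp (-(1/2*y)) * Real.exp (-(1/2*y)) := by
    rw [← Real.exp_add]; ring_nf
  have h2 : Real.exp (1/2*y) * Real.exp (-(1/2*y)) = 1 := by rw [← Real.exp_add]; simp
  have h3 : 1/2*y + 1 ≤ Real.exp (1/2*y) := Real.add_one_le_exp _
  have h4 : (1 + y) ≤ 3 * Real.exp (1/2*y) := by linarith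
  have h5 : 0 < Real.exp (1/2*y) := Real.exp_pos _
  have h6 : 0 < Real.exp (-(1/2*y)) := Real.exp_pos _
  calc Real.exp (1/2*y) * |g y| ≤ Real.exp (1/2*y) * (M * (1 + y) * Real.exp (-y)) := by gcongr
    _ ≤ Real.exp (1/2*y) * (M * (3 * Real.exp (1/2*y)) * Real.exp (-y)) := by gcongr
    _ = 3 * M * ((Real.exp (1/2*y) * Real.exp (-(1/2*y))) * (Real.exp (1/2*y) * Real.exp (-(1/2*y)))) := by
        rw [h1]; ring
    _ = 3 * M := by rw [h2]; ring

lemma hd_exp_mul {g g' : ℝ → ℝ} {y : ℝ} (h : HasDerivAt g (g' y) y) :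
    HasDerivAt (fun y => ((Real.exp (1/2*y) * g y : ℝ) : ℂ))
      ((Real.exp (1/2*y) * (g' y + g y / 2) : ℝ) : ℂ) y := by
  have h1 : HasDerivAt (fun y : ℝ => Real.exp (1/2*y)) (Real.exp (1/2*y) * (1/2*1)) y :=
    ((hasDerivAt_id y).const_mul (1/2:ℝ)).exp
  exact ((h1.mul h).congr_deriv (by ring)).ofReal_comp

/-- the kernel `h_x(z) = 1 - (z-1)^2/(z-x)^2` -/
def hker (x : ℝ) (z : ℂ) : ℂ := (1 - x) * (2 * z - 1 - x) / (z - x)^2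

namespace NiceFlow
variable {U V W : ℝ → ℝ} {C : ℝ}


lemma cU (n : NiceFlow U V W C) : Continuous U := n.smooth.continuous
lemma cV (n : NiceFlow U V W C) : Continuous V := continuous_iff_continuousAt.2 fun y => (n.dV y).continuousAt

lemma dF (n : NiceFlow U V W C) (y : ℝ) : HasDerivAt (fun y => 1 - U y + y * V y) (y * W y) y := by
  have := ((hasDerivAt_const y (1:ℝ)).sub (n.dU y)).add ((hasDerivAt_id y).mul (n.dV y))
  exact this.congr_deriv (by simp)

lemma bF (n : NiceFlow U V W C) (y : ℝ) (hy : 0 ≤ y) : |1 - U y + y * V y| ≤ C * (1 + y) * Real.exp (-y) := by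
  have h1 := n.b0 y hy
  have h2 := n.b1 y hy
  have h3 : |1 - U y| ≤ C * Real.exp (-y) := by
    rw [abs_of_nonneg (by linarith [n.le_one y hy])]; exact h1
  calc _ ≤ |1 - U y| + |y * V y| := abs_add_le _ _
    _ ≤ C * Real.exp (-y) + y * (C * Real.exp (-y)) := by
        rw [abs_mul, abs_of_nonneg hy]; gcongr
    _ = _ := by ring

lemma b1' (n : NiceFlow U V W C) (y : ℝ) (hy : 0 ≤ y) : |V y| ≤ C * (1 + y) * Real.exp (-y) := by
  have := n.hC
  have h : 0 ≤ C * y * Real.exp (-y) := by positivity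
  linarith [n.b1 y hy]

lemma b1d (n : NiceFlow U V W C) (y : ℝ) (hy : 0 ≤ y) : |W y + V y / 2| ≤ (2 * C) * (1 + y) * Real.exp (-y) := by
  have := n.hC
  have h : 0 ≤ C * y * Real.exp (-y) := by positivity
  have h' : 0 ≤ C * Real.exp (-y) := by positivity
  have h1 := abs_le.1 (n.b1 y hy)
  have h2 := abs_le.1 (n.b2 y hy)
  rw [abs_le]; constructor <;> linarith

lemma bFd (n : NiceFlow U V W C) (y : ℝ) (hy : 0 ≤ y) :
    |y * W y + (1 - U y + y * V y) / 2| ≤ (2 * C) * (1 + y) * Real.exp (-y) := by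
  have := n.hC
  have h : 0 ≤ C * y * Real.exp (-y) := by positivity
  have h' : 0 ≤ C * Real.exp (-y) := by positivity
  have h1 := abs_le.1 (n.bF y hy)
  have h2 : |y * W y| ≤ y * (C * Real.exp (-y)) := by
    rw [abs_mul, abs_of_nonneg hy]; exact mul_le_mul_of_nonneg_left (n.b2 y hy) hy
  have h2 := abs_le.1 h2
  rw [abs_le]; constructor <;> linarith

lemma lip (n : NiceFlow U V W C) (y : ℝ) (hy : 0 ≤ y) : U y ≤ (6 * C) * y := by
  have hC := n.hC
  have := Convex.norm_image_sub_le_of_norm_hasDerivWithin_le (f := U) (f' := V) (s := Ici 0) (C := C)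
    (fun z _ => (n.dU z).hasDerivWithinAt) (fun z hz => by
      rw [Real.norm_eq_abs]
      refine (n.b1 z hz).trans ?_
      have : Real.exp (-z) ≤ 1 := Real.exp_le_one_iff.2 (by simpa using hz)
      nlinarith) (convex_Ici 0) (x := 0) (y := y) (by simp) hy
  rw [n.zero, sub_zero, sub_zero, Real.norm_eq_abs, Real.norm_eq_abs, abs_of_nonneg hy] at this
  have := (le_abs_self _).trans this
  nlinarith

def toCoef (n : NiceFlow U V W C) : Coef where
  u := U
  UX := mkX (fun y => (U y : ℂ)) (Complex.continuous_ofReal.comp n.cU) 1 (fun y hy => by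
    rw [Complex.norm_real, Real.norm_eq_abs, abs_of_nonneg (n.nonneg y hy)]; exact n.le_one y hy)
  U1 := mkX (fun y => ((Real.exp (1/2*y) * V y : ℝ) : ℂ))
    (by have := n.cV; fun_prop) (3 * C)
    (fun y hy => exp_half_bound y hy V C (by linarith [n.hC]) (n.b1' y hy))
  U1d := mkX (fun y => ((Real.exp (1/2*y) * (W y + V y / 2) : ℝ) : ℂ))
    (by have := n.cV; have := n.cW; fun_prop) (3 * (2 * C))
    (fun y hy => exp_half_bound y hy (fun y => W y + V y / 2) (2 * C) (by linarith [n.hC]) (n.b1d y hy))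
  ff := mkX (fun y => ((Real.exp (1/2*y) * (1 - U y + y * V y) : ℝ) : ℂ))
    (by have := n.cV; have := n.cU; fun_prop) (3 * C)
    (fun y hy => exp_half_bound y hy (fun y => 1 - U y + y * V y) C (by linarith [n.hC]) (n.bF y hy))
  ffd := mkX (fun y => ((Real.exp (1/2*y) * (y * W y + (1 - U y + y * V y) / 2) : ℝ) : ℂ))
    (by have := n.cV; have := n.cW; have := n.cU; fun_prop) (3 * (2 * C))
    (fun y hy => exp_half_bound y hy (fun y => y * W y + (1 - U y + y * V y) / 2) (2 * C)
      (by linarith [n.hC]) (n.bFd y hy))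
  G := 6 * C
  hG := by linarith [n.hC]
  hu := n.cU
  hUX := fun y hy => xext_mkX _ _ _ _ y hy
  u_nonneg := n.nonneg
  u_le := n.le_one
  u_lip := n.lip
  dU := fun y hy => by
    refine hasDerivAt_xext (fun z hz => xext_mkX _ _ _ _ z hz) hy ?_
    refine (n.dU y).ofReal_comp.congr_deriv ?_
    rw [xext_mul, xext_Eh y hy.le, xext_mkX _ _ _ _ y hy.le, wexp, ← Complex.ofReal_mul, ← mul_assoc,
      ← Real.exp_add]
    simp
  dU1 := fun y hy => by
    rw [xext_mkX _ _ _ _ y hy.le]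
    exact hasDerivAt_xext (fun z hz => xext_mkX _ _ _ _ z hz) hy (hd_exp_mul (n.dV y))
  dff := fun y hy => by
    rw [xext_mkX _ _ _ _ y hy.le]
    exact hasDerivAt_xext (fun z hz => xext_mkX _ _ _ _ z hz) hy
      (hd_exp_mul (g := fun y => 1 - U y + y * V y) (g' := fun y => y * W y) (n.dF y))
  u_zero := n.zero
  ff_zero := by rw [xext_mkX _ _ _ _ 0 le_rfl]; simp [n.zero]
  bU1 := (mkX_norm _ _ _ _).trans (by linarith [n.hC])
  bU1d := (mkX_norm _ _ _ _).trans (by linarith [n.hC])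
  bff := (mkX_norm _ _ _ _).trans (by linarith [n.hC])
  bffd := (mkX_norm _ _ _ _).trans (by linarith [n.hC])

lemma Eh_U1 (n : NiceFlow U V W C) (y : ℝ) (hy : 0 ≤ y) : xext Eh y * xext n.toCoef.U1 y = (V y : ℂ) := by
  rw [xext_Eh y hy]
  refine (congrArg _ (xext_mkX _ _ _ _ y hy)).trans ?_
  rw [wexp, ← Complex.ofReal_mul, ← mul_assoc, ← Real.exp_add]; simp

lemma Eh_ff (n : NiceFlow U V W C) (y : ℝ) (hy : 0 ≤ y) : xext Eh y * xext n.toCoef.ff y = ((1 - U y + y * V y : ℝ) : ℂ) := by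
  rw [xext_Eh y hy]
  refine (congrArg _ (xext_mkX _ _ _ _ y hy)).trans ?_
  rw [wexp, ← Complex.ofReal_mul, ← mul_assoc, ← Real.exp_add]; simp

lemma toCoef_u (n : NiceFlow U V W C) : n.toCoef.u = U := rfl

lemma derivU (n : NiceFlow U V W C) : deriv U = V := funext fun y => (n.dU y).deriv

lemma srcF_eq (n : NiceFlow U V W C) (y : ℝ) : srcF U y = 1 - U y + y * V y := by rw [srcF, n.derivU]

lemma smoothV (n : NiceFlow U V W C) : ContDiff ℝ (⊤ : ℕ∞) V := by
  rw [← n.derivU]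
  exact (contDiff_infty_iff_deriv.1 n.smooth).2

/-- reconstruction of the eigenmode -/
lemma recon (n : NiceFlow U V W C) (μ : ℂ) (k : ℝ) (hk : 0 < k) (x x1 x2 : XX) (h1 : DD x x1) (h2 : DD x1 x2)
    (h0 : xext x 0 = 1)
    (he : n.toCoef.Nx μ * x + n.toCoef.U1 * opJ x - (Complex.I / k) • (x2 - x1 + (1/4 : ℂ) • x)
      = n.toCoef.ff) :
    ∃ φ, IsEigSolution U μ k (opEll x) φ := by
  have dE : DD Eh ((-((1/2:ℝ):ℂ)) • Eh) := DD_expX _ _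
  have hkc : (k:ℂ) ≠ 0 := by exact_mod_cast hk.ne'
  have hdiv : Complex.I / (k:ℂ) * (-(Complex.I * k)) = 1 := by
    field_simp; simp
  have hdiv' : (-(Complex.I * k)) * (Complex.I / (k:ℂ)) = 1 := by rw [mul_comm]; exact hdiv
  have c1 : ContDiff ℝ (⊤ : ℕ∞) (fun y => (U y : ℂ)) := Complex.ofRealCLM.contDiff.comp n.smooth
  have c2 : ContDiff ℝ (⊤ : ℕ∞) (fun y => (V y : ℂ)) := Complex.ofRealCLM.contDiff.comp n.smoothV
  have c3 : ContDiff ℝ (⊤ : ℕ∞) (fun y : ℝ => (y : ℂ)) := Complex.ofRealCLM.contDiff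
  have D1 : DD (Eh * x) (Eh * (x1 - (1/2:ℂ) • x)) := (dE.mul h1).congr (xx_ext fun y hy => by
    simp only [xext_add, xext_mul, xext_smul, xext_sub]; push_cast; ring)
  have D2 : DD (Eh * (x1 - (1/2:ℂ) • x)) (Eh * (x2 - x1 + (1/4:ℂ) • x)) :=
    (dE.mul (h2.sub (h1.smul _))).congr (xx_ext fun y hy => by
    simp only [xext_add, xext_mul, xext_smul, xext_sub]; push_cast; ring)
  have heq : ∀ y, 0 ≤ y → xext (Eh * (x2 - x1 + (1/4:ℂ) • x)) y =
      (-(Complex.I * k) * (μ - U y)) * xext (Eh * x) y + (-(Complex.I * k) * V y) * xext (opJ x) y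
        + (Complex.I * k) * ((1 - U y + y * V y : ℝ) : ℂ) := by
    intro y hy
    have e := congrArg (fun v => xext v y) he
    simp only [xext_add, xext_mul, xext_smul, xext_sub] at e ⊢
    rw [n.toCoef.Nx_apply μ y hy, n.toCoef_u] at e
    have e1 := n.Eh_U1 y hy
    have e2 := n.Eh_ff y hy
    rw [← e2, ← e1, ← e]
    linear_combination (-(xext Eh y * (xext x2 y - xext x1 y + 1/4 * xext x y))) * hdiv'
  obtain ⟨φ, hφ, hφ'⟩ := smooth_extend (fun y => -(Complex.I * k) * (μ - U y))
    (fun y => -(Complex.I * k) * V y) (fun y => (Complex.I * k) * ((1 - U y + y * V y : ℝ) : ℂ))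
    (xext (opJ x)) (xext (Eh * x)) (xext (Eh * (x1 - (1/2:ℂ) • x)))
    (by fun_prop) (by fun_prop) (by push_cast; fun_prop)
    (xext_cont _) (xext_cont _) (xext_cont _) (DD_J x) D1
    (fun y hy => (D2 y hy).congr_deriv (heq y hy.le))
  refine ⟨φ, hφ, fun y hy => ?_, ?_, ?_, ?_, ?_⟩
  · obtain ⟨a1, a2, a3⟩ := hφ' y hy
    rw [a1, a2, a3, n.srcF_eq, n.derivU]
    linear_combination ((μ - U y) * xext (Eh * x) y + V y * xext (opJ x) y
      - ((1 - U y + y * V y : ℝ) : ℂ)) * (-hdiv)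
  · rw [(hφ' 0 le_rfl).1, J_zero]
  · rw [(hφ' 0 le_rfl).2.1, xext_mul, h0, xext_Eh 0 le_rfl, wexp_zero, one_mul]
  · have : Tendsto (xext (Eh * x)) atTop (nhds 0) := by
      refine squeeze_zero_norm' (a := fun y => Real.exp (-(1/2) * y) * ‖x‖) ?_ ?_
      · filter_upwards [eventually_ge_atTop 0] with y hy
        rw [xext_mul, norm_mul, xext_Eh y hy, wexp_norm]
        gcongr; exact xext_norm_le _ _
      · rw [← zero_mul ‖x‖]
        refine Tendsto.mul_const _ (Real.tendsto_exp_atBot.comp ?_)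
        exact tendsto_id.const_mul_atTop_of_neg (by norm_num)
    refine this.congr' ?_
    filter_upwards [eventually_ge_atTop 0] with y hy using (hφ' y hy).2.1.symm
  · refine (tendsto_J x).congr' ?_
    filter_upwards [eventually_ge_atTop 0] with y hy using (hφ' y hy).1.symm

/-- the limit of `U` -/
lemma tendsto_one (n : NiceFlow U V W C) : Tendsto U atTop (nhds 1) := by
  have h : Tendsto (fun y => 1 - U y) atTop (nhds 0) := by
    refine squeeze_zero' (g := fun y => C * Real.exp (-y)) ?_ ?_ ?_
    · filter_upwards [eventually_ge_atTop 0] with y hy using by linarith [n.le_one y hy]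
    · filter_upwards [eventually_ge_atTop 0] with y hy using n.b0 y hy
    · rw [← mul_zero C]; exact Real.tendsto_exp_neg_atTop_nhds_zero.const_mul C
  have := (tendsto_const_nhds (x := (1:ℝ))).sub h
  simpa using this

lemma y_defect (n : NiceFlow U V W C) : Tendsto (fun y => y * (1 - U y)) atTop (nhds 0) := by
  have h := (Real.tendsto_pow_mul_exp_neg_atTop_nhds_zero 1).const_mul C
  rw [mul_zero] at h
  refine squeeze_zero' ?_ ?_ h
  · filter_upwards [eventually_ge_atTop 0] with y hy using mul_nonneg hy (by linarith [n.le_one y hy])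
  · filter_upwards [eventually_ge_atTop 0] with y hy
    have := mul_le_mul_of_nonneg_left (n.b0 y hy) hy
    rw [pow_one]; linarith

lemma ell_v0 (n : NiceFlow U V W C) (μ : ℂ) (h : 0 < μ.im) : opEll (n.toCoef.v0 μ h) =
    (μ - 1) * ∫ y in Ioi (0:ℝ), ((1 - U y + y * V y : ℝ) : ℂ) / (μ - U y)^2 := by
  have t1 := tendsto_J (n.toCoef.v0 μ h)
  set m := n.toCoef.Mx μ h * (n.toCoef.Mx μ h * n.toCoef.ff) with hm
  have t2 : Tendsto (xext (opJ (n.toCoef.v0 μ h))) atTop (nhds ((μ - (1:ℝ)) * opEll m)) := by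
    rw [Coef.J_v0]
    have : Tendsto (fun y => (μ - (U y : ℂ)) * xext (opJ m) y) atTop (nhds ((μ - (1:ℝ)) * opEll m)) :=
      (tendsto_const_nhds.sub ((Complex.continuous_ofReal.tendsto _).comp n.tendsto_one)).mul (tendsto_J m)
    refine this.congr' ?_
    filter_upwards [eventually_ge_atTop 0] with y hy
    rw [xext_mul, n.toCoef.Nx_apply μ y hy, n.toCoef_u]
  rw [tendsto_nhds_unique t1 t2, opEll_apply, Complex.ofReal_one]
  congr 1
  refine setIntegral_congr_fun measurableSet_Ioi fun y hy => ?_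
  have hy : 0 ≤ y := le_of_lt hy
  have e2 := n.Eh_ff y hy
  simp only [hm, xext_mul, n.toCoef.Mx_apply μ h y hy, n.toCoef_u]
  have hne := Coef.den_ne μ h (U y)
  rw [← e2, xext_Eh y hy]
  generalize wexp (-(1/2)) y = w
  field_simp

lemma intble_defect (n : NiceFlow U V W C) : IntegrableOn (fun y => 1 - U y) (Ioi (0:ℝ)) := by
  have h0 : IntegrableOn (fun y => C * Real.exp (-y)) (Ioi (0:ℝ)) :=
    (integrableOn_exp_neg_Ioi 0).const_mul C
  refine h0.mono' (continuous_const.sub n.cU).aestronglyMeasurable ?_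
  filter_upwards [ae_restrict_mem measurableSet_Ioi] with y hy
  have hy : 0 ≤ y := le_of_lt hy
  rw [Real.norm_eq_abs, abs_of_nonneg (by linarith [n.le_one y hy])]; exact n.b0 y hy

lemma intble_F (n : NiceFlow U V W C) (μ : ℂ) (h : 0 < μ.im) :
    IntegrableOn (fun y => ((1 - U y + y * V y : ℝ) : ℂ) / (μ - U y)^2) (Ioi (0:ℝ)) := by
  have := intble_wexp_mul (1/2) (by norm_num) (n.toCoef.Mx μ h * (n.toCoef.Mx μ h * n.toCoef.ff)) 0
  refine this.congr_fun (fun y hy => ?_) measurableSet_Ioi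
  have hy : 0 ≤ y := le_of_lt hy
  have e2 := n.Eh_ff y hy
  simp only [xext_mul, n.toCoef.Mx_apply μ h y hy, n.toCoef_u]
  have hne := Coef.den_ne μ h (U y)
  rw [← e2, xext_Eh y hy]
  generalize wexp (-(1/2)) y = w
  field_simp

lemma intble_hker (n : NiceFlow U V W C) (μ : ℂ) (h : 0 < μ.im) :
    IntegrableOn (fun y => hker (U y) μ) (Ioi (0:ℝ)) := by
  have hne : ∀ y, μ - (U y : ℂ) ≠ 0 := fun y => Coef.den_ne μ h (U y)
  have hc : Continuous (fun y => hker (U y) μ) := by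
    unfold hker
    have := n.cU
    refine Continuous.div (by fun_prop) (by fun_prop) fun y => pow_ne_zero _ (hne y)
  refine Integrable.mono' (g := fun y => (1 - U y) * ((2 * ‖μ‖ + 2) * (μ.im⁻¹)^2))
    (n.intble_defect.mul_const _) hc.aestronglyMeasurable ?_
  filter_upwards [ae_restrict_mem measurableSet_Ioi] with y hy
  have hy : 0 ≤ y := le_of_lt hy
  unfold hker
  rw [div_eq_mul_inv, norm_mul, norm_mul, ← inv_pow, norm_pow, mul_assoc]
  have a1 : ‖(1:ℂ) - U y‖ = 1 - U y := by
    rw [← Complex.ofReal_one, ← Complex.ofReal_sub, Complex.norm_real, Real.norm_eq_abs,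
      abs_of_nonneg (by linarith [n.le_one y hy])]
  have a2 : ‖2 * μ - 1 - (U y : ℂ)‖ ≤ 2 * ‖μ‖ + 2 := by
    refine (norm_sub_le _ _).trans ?_
    have b1 : ‖(U y : ℂ)‖ ≤ 1 := by
      rw [Complex.norm_real, Real.norm_eq_abs, abs_of_nonneg (n.nonneg y hy)]; exact n.le_one y hy
    have b2 : ‖2 * μ - 1‖ ≤ 2 * ‖μ‖ + 1 := by
      refine (norm_sub_le _ _).trans ?_
      rw [norm_mul]; simp
    linarith
  have a3 := Coef.den_bound μ μ.im h le_rfl (U y)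
  rw [a1]
  have : 0 ≤ 1 - U y := by linarith [n.le_one y hy]
  gcongr

lemma ell_v0' (n : NiceFlow U V W C) (μ : ℂ) (h : 0 < μ.im) : opEll (n.toCoef.v0 μ h) =
    ∫ y in Ioi (0:ℝ), hker (U y) μ := by
  rw [n.ell_v0 μ h, ← integral_const_mul, ← sub_eq_zero,
    ← integral_sub ((n.intble_F μ h).const_mul _) (n.intble_hker μ h)]
  have hne : ∀ y, μ - (U y : ℂ) ≠ 0 := fun y => Coef.den_ne μ h (U y)
  have key := integral_Ioi_of_hasDerivAt_of_tendsto' (a := 0)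
    (f := fun y => -((y * (1 - U y) : ℝ) : ℂ) / (μ - U y))
    (f' := fun y => (μ - 1) * (((1 - U y + y * V y : ℝ) : ℂ) / (μ - U y)^2) - hker (U y) μ) (m := 0)
    (fun y _ => ?_) (Integrable.sub ((n.intble_F μ h).const_mul _) (n.intble_hker μ h)) ?_
  · rw [key]; simp
  · have h1 : HasDerivAt (fun y => (((y * (1 - U y) : ℝ)) : ℂ)) (((1 - U y) - y * V y : ℝ) : ℂ) y := by
      refine HasDerivAt.ofReal_comp ?_
      have := (hasDerivAt_id y).mul ((hasDerivAt_const y (1:ℝ)).sub (n.dU y))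
      exact this.congr_deriv (by simp; ring)
    have h2 : HasDerivAt (fun y => μ - (U y : ℂ)) (-(V y : ℂ)) y :=
      ((hasDerivAt_const y μ).sub (n.dU y).ofReal_comp).congr_deriv (by simp)
    have h1' : HasDerivAt (fun y => -(((y * (1 - U y) : ℝ)) : ℂ)) (-(((1 - U y) - y * V y : ℝ) : ℂ)) y := h1.neg
    refine (h1'.div h2 (hne y)).congr_deriv ?_
    unfold hker
    have := hne y
    field_simp
    push_cast
    ring
  · have a1 : Tendsto (fun y => -((y * (1 - U y) : ℝ) : ℂ)) atTop (nhds (-((0:ℝ):ℂ))) :=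
      ((Complex.continuous_ofReal.tendsto _).comp n.y_defect).neg
    have a2 : Tendsto (fun y => (μ - (U y : ℂ))) atTop (nhds (μ - ((1:ℝ):ℂ))) :=
      (tendsto_const_nhds.sub ((Complex.continuous_ofReal.tendsto _).comp n.tendsto_one))
    have := a1.div a2 (Coef.den_ne μ h 1)
    rw [Complex.ofReal_zero, neg_zero, zero_div] at this
    exact this

end NiceFlow

end

section

/-! ### Algebra: the two-step profile -/

lemma hker_formula (μ : ℂ) (hb : 0 < μ.im) (x : ℝ) :
    hker x μ = (((1 - x) / ((μ.re - x)^2 + μ.im^2)^2 : ℝ) : ℂ) *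
      (⟨(2*μ.re - 1 - x) * ((μ.re - x)^2 - μ.im^2) + 4 * μ.im^2 * (μ.re - x),
        2 * μ.im * ((μ.re - x) * (1 - μ.re) - μ.im^2)⟩ : ℂ) := by
  obtain ⟨a, b⟩ := μ
  simp only at hb ⊢
  have hN : (a - x)^2 + b^2 ≠ 0 := by positivity
  have hne : (⟨a, b⟩ : ℂ) - (x : ℂ) ≠ 0 := Coef.den_ne ⟨a, b⟩ hb x
  have e1 : (((a - x)^2 + b^2 : ℝ) : ℂ) = ((⟨a, b⟩ : ℂ) - x) * ((⟨a, -b⟩ : ℂ) - x) := by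
    rw [Complex.mk_eq_add_mul_I a b, Complex.mk_eq_add_mul_I a (-b)]
    push_cast
    linear_combination (b:ℂ)^2 * Complex.I_sq
  have e2 : (⟨(2*a - 1 - x) * ((a - x)^2 - b^2) + 4 * b^2 * (a - x),
        2 * b * ((a - x) * (1 - a) - b^2)⟩ : ℂ) =
      (2 * (⟨a, b⟩ : ℂ) - 1 - x) * ((⟨a, -b⟩ : ℂ) - x)^2 := by
    rw [Complex.mk_eq_add_mul_I a b, Complex.mk_eq_add_mul_I a (-b), Complex.mk_eq_add_mul_I _ (2 * _ * _)]
    push_cast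
    linear_combination (-(b:ℂ)^2 * (2 * a - 1 - x) + 4 * b^2 * (a - x) - 2 * b^3 * Complex.I) * Complex.I_sq
  have hne' : (⟨a, -b⟩ : ℂ) - (x : ℂ) ≠ 0 := by
    intro h
    rw [h, mul_zero] at e1
    exact hN (by exact_mod_cast e1)
  rw [e2, Complex.ofReal_div, Complex.ofReal_pow, e1, hker]
  push_cast
  field_simp

lemma gamma2_algebra (μ : ℂ) (ha : 0 < μ.re) (ha1 : μ.re < 2/3) (hb : 0 < μ.im)
    (hb1 : μ.im^2 < μ.re * (2 - 3 * μ.re) / 3) :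
    ∃ x β : ℝ, 0 < x ∧ x < 1 ∧ 0 < β ∧ hker 0 μ + β * hker x μ = 0 := by
  set a := μ.re with haa
  set b := μ.im with hbb
  set R : ℝ → ℝ := fun x => (2*a - 1 - x) * ((a - x)^2 - b^2) + 4 * b^2 * (a - x) with hR
  set I : ℝ → ℝ := fun x => 2 * b * ((a - x) * (1 - a) - b^2) with hI
  set c := b^2 / (1 - a) with hc
  have h1a : 0 < 1 - a := by linarith
  have hcb : b^2 = c * (1 - a) := by rw [hc]; field_simp
  have hc0 : 0 < c := by positivity
  have hca : c < a := by
    rw [hc, div_lt_iff₀ h1a]; nlinarith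
  have hI0 : 0 < I 0 := by
    have : 0 < (a - 0) * (1 - a) - b^2 := by nlinarith
    simp only [hI]; positivity
  set g : ℝ → ℝ := fun x => I 0 * R x - R 0 * I x with hg
  have hgc : Continuous g := by simp only [hg, hI, hR]; fun_prop
  have gx : 0 < g (a - c) := by
    have i : I (a - c) = 0 := by simp only [hI]; rw [hcb]; ring
    have r : R (a - c) = c * (c + (1 - a))^2 := by simp only [hR]; rw [hcb]; ring
    simp only [hg, i, r]
    rw [mul_zero, sub_zero]; positivity
  have g1 : g 1 < 0 := by
    have : g 1 = 2 * ((a-1)^2 + b^2) * (b * (3 * (a^2+b^2) - 2 * a) * (a^2 + b^2)) ∨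
        g 1 = 2 * ((a-1)^2 + b^2) * (b * (3 * (a^2+b^2) - 2 * a)) := by
      right; simp only [hg, hI, hR]; ring
    have h3 : 3 * (a^2+b^2) - 2 * a < 0 := by nlinarith
    have h4 : 0 < a^2 + b^2 := by positivity
    have h5 : 0 < (a-1)^2 + b^2 := by positivity
    rcases this with h | h <;> rw [h]
    · exact mul_neg_of_pos_of_neg (by positivity)
        (mul_neg_of_neg_of_pos (mul_neg_of_pos_of_neg hb h3) h4)
    · exact mul_neg_of_pos_of_neg (by positivity) (mul_neg_of_pos_of_neg hb h3)
  obtain ⟨x, ⟨hx1, hx2⟩, hx⟩ := intermediate_value_Ioo' (show a - c ≤ 1 by linarith)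
    hgc.continuousOn (show (0:ℝ) ∈ Ioo (g 1) (g (a - c)) from ⟨g1, gx⟩)
  have hIx : I x < 0 := by
    have : (a - x) * (1 - a) - b^2 < 0 := by rw [hcb]; nlinarith
    simp only [hI]
    exact mul_neg_of_pos_of_neg (by linarith) this
  have hN0 : 0 < (a - 0)^2 + b^2 := by positivity
  have hNx : 0 < (a - x)^2 + b^2 := by positivity
  have hx0 : 0 < 1 - x := by linarith
  refine ⟨x, (I 0 / -(I x)) * (((a - x)^2 + b^2)^2 / (1 - x) * (1 / ((a-0)^2+b^2)^2)), by linarith, hx2, ?_, ?_⟩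
  · have : 0 < -(I x) := by linarith
    positivity
  · rw [hker_formula μ hb 0, hker_formula μ hb x, ← haa, ← hbb]
    change _ * (⟨R 0, I 0⟩ : ℂ) + _ * (_ * (⟨R x, I x⟩ : ℂ)) = 0
    have hx' : I 0 * R x - R 0 * I x = 0 := hx
    rw [← mul_assoc, ← Complex.ofReal_mul]
    have k : (I 0 / -(I x)) * (((a - x)^2 + b^2)^2 / (1 - x) * (1 / ((a-0)^2+b^2)^2)) *
      ((1 - x) / ((a - x)^2 + b^2)^2) = (1 / ((a-0)^2+b^2)^2) * (I 0 / -(I x)) := by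
      field_simp
    rw [k, sub_zero]
    have hne := hIx.ne
    apply Complex.ext
    · simp only [Complex.add_re, Complex.re_ofReal_mul, Complex.zero_re]
      have : R 0 = I 0 * R x / I x := by field_simp; linarith
      rw [this]; field_simp; ring
    · simp only [Complex.add_im, Complex.im_ofReal_mul, Complex.zero_im]
      field_simp; ring

lemma H_isolated (μ : ℂ) (hb : 0 < μ.im) (x β : ℝ) (hx : 0 < x) (ε : ℝ) (hε : 0 < ε) :
    ∃ r η : ℝ, 0 < r ∧ r ≤ ε ∧ r ≤ μ.im / 2 ∧ 0 < η ∧ ∀ z : ℂ, ‖z - μ‖ = r →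
      η ≤ ‖hker 0 z + β * hker x z‖ := by
  set P : Polynomial ℂ := (2 * Polynomial.X - 1) * (Polynomial.X - Polynomial.C (x:ℂ))^2 +
    Polynomial.C ((β:ℂ) * (1 - x)) * (2 * Polynomial.X - 1 - Polynomial.C (x:ℂ)) * Polynomial.X^2 with hP
  have hev : ∀ z, P.eval z = (2 * z - 1) * (z - x)^2 + (β * (1 - x)) * (2 * z - 1 - x) * z^2 := by
    intro z; simp [hP]
  have hP0 : P ≠ 0 := by
    intro h
    have := hev 0
    rw [h] at this
    simp at this
    exact hx.ne' this
  have hfin : {z | P.IsRoot z}.Finite := Polynomial.finite_setOfPred_isRoot hP0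
  have hop : ({z | P.IsRoot z} \ {μ})ᶜ ∈ nhds μ :=
    (hfin.subset diff_subset).isClosed.isOpen_compl.mem_nhds (by simp)
  obtain ⟨r0, hr0, hball⟩ := Metric.mem_nhds_iff.1 hop
  set r := min (r0/2) (min ε (μ.im/2)) with hr
  have hrpos : 0 < r := by rw [hr]; positivity
  have hrr0 : r < r0 := (min_le_left _ _).trans_lt (by linarith)
  have hri : r ≤ μ.im / 2 := (min_le_right _ _).trans (min_le_right _ _)
  have him : ∀ z : ℂ, ‖z - μ‖ ≤ r → 0 < z.im := by
    intro z hz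
    have h1 := Complex.abs_im_le_norm (z - μ)
    rw [Complex.sub_im] at h1
    have := (abs_le.1 (h1.trans hz)).1
    linarith
  have hne : ∀ z : ℂ, ‖z - μ‖ = r → hker 0 z + β * hker x z ≠ 0 := by
    intro z hz h
    have i := him z hz.le
    have n0 : z ≠ 0 := by simpa using Coef.den_ne z i 0
    have n1 := Coef.den_ne z i x
    have hroot : P.eval z = 0 := by
      rw [hev]
      have : (2 * z - 1) * (z - x)^2 + (β * (1 - x)) * (2 * z - 1 - x) * z^2 =
          (hker 0 z + β * hker x z) * (z^2 * (z - x)^2) := by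
        unfold hker
        simp only [Complex.ofReal_zero, sub_zero]
        field_simp
      rw [this, h, zero_mul]
    have hzb : z ∈ Metric.ball μ r0 := by rw [Metric.mem_ball, dist_eq_norm, hz]; exact hrr0
    have := hball hzb
    apply this
    refine ⟨hroot, ?_⟩
    intro hzm
    rw [mem_singleton_iff] at hzm
    rw [hzm, sub_self, norm_zero] at hz
    linarith
  have hcont : ContinuousOn (fun z => ‖hker 0 z + β * hker x z‖) (Metric.sphere μ r) := by
    have h : ∀ x : ℝ, ContinuousOn (fun z => hker x z) (Metric.sphere μ r) := by
      intro x
      unfold hker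
      refine ContinuousOn.div (by fun_prop) (by fun_prop) fun z hz => pow_ne_zero _ ?_
      refine Coef.den_ne z (him z ?_) x
      rw [← dist_eq_norm]; exact (Metric.mem_sphere.1 hz).le
    exact ((h 0).add (continuousOn_const.mul (h x))).norm
  obtain ⟨w, hw, hmin⟩ := (isCompact_sphere μ r).exists_isMinOn
    (NormedSpace.sphere_nonempty.2 hrpos.le) hcont
  refine ⟨r, ‖hker 0 w + β * hker x w‖, hrpos, (min_le_right _ _).trans (min_le_left _ _), hri,
    norm_pos_iff.2 (hne w (by rw [← dist_eq_norm]; exact hw)), fun z hz => ?_⟩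
  exact hmin (show z ∈ Metric.sphere μ r by rw [Metric.mem_sphere, dist_eq_norm, hz])

lemma exists_zero_of_small_center (f : ℂ → ℂ) (μ : ℂ) (r A : ℝ) (hr : 0 < r)
    (hf : ∀ z, ‖z - μ‖ ≤ r → DifferentiableAt ℂ f z) (hc : ‖f μ‖ ≤ A) (B : ℝ) (hAB : A < B)
    (hs : ∀ z, ‖z - μ‖ = r → B ≤ ‖f z‖) : ∃ z, ‖z - μ‖ ≤ r ∧ f z = 0 := by
  by_contra! hne
  have hmem : ∀ z ∈ Metric.closedBall μ r, ‖z - μ‖ ≤ r := fun z hz => by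
    rw [← dist_eq_norm]; exact hz
  have hA : 0 < ‖f μ‖ := norm_pos_iff.2 (hne μ (by simpa using hr.le))
  have hB : 0 < B := by linarith
  have hd : DiffContOnCl ℂ (fun z => (f z)⁻¹) (Metric.ball μ r) := by
    refine DifferentiableOn.diffContOnCl ?_
    rw [closure_ball μ hr.ne']
    intro z hz
    exact ((hf z (hmem z hz)).inv (hne z (hmem z hz))).differentiableWithinAt
  have := Complex.norm_le_of_forall_mem_frontier_norm_le (C := B⁻¹) Metric.isBounded_ball hd
    (fun z hz => by
      rw [frontier_ball μ hr.ne', Metric.mem_sphere, dist_eq_norm] at hz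
      rw [norm_inv]
      exact inv_anti₀ hB (hs z hz)) (subset_closure (Metric.mem_ball_self hr))
  rw [norm_inv] at this
  have := (inv_le_inv₀ hA hB).1 this
  linarith

end

section

/-! ### The explicit shear flow -/

def fA (E y : ℝ) : ℝ := (Real.exp y - 1) / (Real.exp y + E)
def fB (E y : ℝ) : ℝ := (1 + E) * Real.exp y / (Real.exp y + E)^2
def fC (E y : ℝ) : ℝ := fB E y * ((E - Real.exp y) / (Real.exp y + E))
def fD (E y : ℝ) : ℝ := fC E y * ((E - Real.exp y) / (Real.exp y + E)) +
  fB E y * (-(2 * E * Real.exp y) / (Real.exp y + E)^2)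

section basic
variable {E : ℝ}


lemma fpos (hE : 1 < E) (y : ℝ) : 0 < Real.exp y + E := by have := Real.exp_pos y; linarith

lemma fA_deriv (hE : 1 < E) (y : ℝ) : HasDerivAt (fA E) (fB E y) y := by
  have h := (fpos hE y).ne'
  refine (((Real.hasDerivAt_exp y).sub_const 1).div ((Real.hasDerivAt_exp y).add_const E) h).congr_deriv ?_
  unfold fB; congr 1; ring

lemma fr_deriv (hE : 1 < E) (y : ℝ) : HasDerivAt (fun y => (E - Real.exp y) / (Real.exp y + E))
    (-(2 * E * Real.exp y) / (Real.exp y + E)^2) y := by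
  have h := (fpos hE y).ne'
  refine (((Real.hasDerivAt_exp y).const_sub E).div ((Real.hasDerivAt_exp y).add_const E) h).congr_deriv ?_
  congr 1; ring

lemma fB_deriv (hE : 1 < E) (y : ℝ) : HasDerivAt (fB E) (fC E y) y := by
  have h := (fpos hE y).ne'
  refine (((Real.hasDerivAt_exp y).const_mul (1+E)).div (((Real.hasDerivAt_exp y).add_const E).pow 2)
    (pow_ne_zero 2 h)).congr_deriv ?_
  simp only [fC, fB, Pi.pow_apply]
  field_simp; ring

lemma fC_deriv (hE : 1 < E) (y : ℝ) : HasDerivAt (fC E) (fD E y) y :=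
  (fB_deriv hE y).mul (fr_deriv hE y)

lemma fA_smooth (hE : 1 < E) : ContDiff ℝ (⊤ : ℕ∞) (fA E) := by
  unfold fA
  exact ContDiff.div (by fun_prop) (by fun_prop) fun y => (fpos hE y).ne'

lemma fC_cont (hE : 1 < E) : Continuous (fC E) :=
  continuous_iff_continuousAt.2 fun y => (fC_deriv hE y).continuousAt

lemma fC_analytic (hE : 1 < E) (y : ℝ) : AnalyticAt ℝ (fC E) y := by
  have h := (fpos hE y).ne'
  unfold fC fB
  refine AnalyticAt.mul (AnalyticAt.div (by fun_prop) (by fun_prop) (pow_ne_zero 2 h))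
    (AnalyticAt.div (by fun_prop) (by fun_prop) h)

lemma fA_sub (hE : 1 < E) (y : ℝ) : 1 - fA E y = (1 + E) / (Real.exp y + E) := by
  have h := (fpos hE y).ne'
  unfold fA; field_simp; ring

lemma fA_lt (hE : 1 < E) (y : ℝ) : fA E y < 1 := by
  have h : 0 < (1 + E) / (Real.exp y + E) := div_pos (by linarith) (fpos hE y)
  have := fA_sub hE y
  linarith

lemma fA_nonneg (hE : 1 < E) (y : ℝ) (hy : 0 ≤ y) : 0 ≤ fA E y :=
  div_nonneg (by linarith [Real.one_le_exp hy]) (fpos hE y).le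

lemma fA_def_le (hE : 1 < E) (y : ℝ) : 1 - fA E y ≤ (1 + E) * Real.exp (-y) := by
  rw [fA_sub hE y, Real.exp_neg, ← div_eq_mul_inv]
  have := Real.exp_pos y
  exact div_le_div_of_nonneg_left (by linarith) this (by linarith)

lemma fB_pos (hE : 1 < E) (y : ℝ) : 0 < fB E y := by
  have := fpos hE y
  unfold fB; positivity

lemma fB_le (hE : 1 < E) (y : ℝ) : fB E y ≤ 1 - fA E y := by
  have h := fpos hE y
  have := Real.exp_pos y
  rw [fA_sub hE y, fB, div_le_div_iff₀ (by positivity) h, sq]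
  have : 0 ≤ (1 + E) * (Real.exp y + E) * E := by positivity
  nlinarith

lemma fB_ge (hE : 1 < E) (y : ℝ) (hy : 0 ≤ y) : 1 - fA E y ≤ (1 + E) * fB E y := by
  have h := fpos hE y
  have h1 := Real.one_le_exp hy
  rw [fA_sub hE y, fB, ← mul_div_assoc, div_le_div_iff₀ h (by positivity), sq]
  have h2 : 0 ≤ (1+E) * (Real.exp y + E) := by positivity
  have h3 : Real.exp y + E ≤ (1 + E) * Real.exp y := by nlinarith
  nlinarith [mul_le_mul_of_nonneg_left h3 h2]

lemma fr_abs (hE : 1 < E) (y : ℝ) : |(E - Real.exp y) / (Real.exp y + E)| ≤ 1 := by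
  have h := fpos hE y
  have := Real.exp_pos y
  rw [abs_div, abs_of_pos h, div_le_one h, abs_le]
  constructor <;> linarith

lemma fC_abs (hE : 1 < E) (y : ℝ) : |fC E y| ≤ fB E y := by
  rw [fC, abs_mul, abs_of_pos (fB_pos hE y)]
  exact mul_le_of_le_one_right (fB_pos hE y).le (fr_abs hE y)

lemma fD_abs (hE : 1 < E) (y : ℝ) : |fD E y| ≤ 3 * fB E y := by
  have h := fpos hE y
  have he := Real.exp_pos y
  have hb := fB_pos hE y
  have h1 : |(-(2 * E * Real.exp y) / (Real.exp y + E)^2)| ≤ 2 := by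
    rw [abs_div, abs_neg, abs_of_pos (by positivity : 0 < 2 * E * Real.exp y), abs_of_pos (by positivity),
      div_le_iff₀ (by positivity)]
    nlinarith
  calc |fD E y| ≤ |fC E y * ((E - Real.exp y) / (Real.exp y + E))| +
      |fB E y * (-(2 * E * Real.exp y) / (Real.exp y + E)^2)| := abs_add_le _ _
    _ ≤ fB E y * 1 + fB E y * 2 := by
      rw [abs_mul, abs_mul, abs_of_pos hb]
      have := fr_abs hE y
      have := fC_abs hE y
      gcongr
    _ = _ := by ring

lemma fC_zero (hE : 1 < E) : 0 < fC E 0 := by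
  have := fB_pos hE 0
  unfold fC
  refine mul_pos this ?_
  rw [Real.exp_zero]
  exact div_pos (by linarith) (by linarith)

lemma fC_far (hE : 1 < E) (y : ℝ) (hy : 3 * E ≤ Real.exp y) : fC E y ≤ - (fB E y / 2) := by
  have h := fpos hE y
  have hb := fB_pos hE y
  have : (E - Real.exp y) / (Real.exp y + E) ≤ -(1/2) := by
    rw [div_le_iff₀ h]; linarith
  unfold fC
  have := mul_le_mul_of_nonneg_left this hb.le
  linarith

end basic

section flow
variable {E1 E2 x : ℝ}

def fU (E1 E2 x y : ℝ) : ℝ := x * fA E1 y + (1 - x) * fA E2 y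
def fV (E1 E2 x y : ℝ) : ℝ := x * fB E1 y + (1 - x) * fB E2 y
def fW (E1 E2 x y : ℝ) : ℝ := x * fC E1 y + (1 - x) * fC E2 y
def fT (E1 E2 x y : ℝ) : ℝ := x * fD E1 y + (1 - x) * fD E2 y




lemma fV_pos (h1 : 1 < E1) (h12 : E1 ≤ E2) (hx : 0 < x) (hx1 : x < 1) (y : ℝ) : 0 < fV E1 E2 x y := by
  have a := fB_pos h1 y
  have b := fB_pos (h1.trans_le h12) y
  have : 0 < 1 - x := by linarith
  unfold fV; positivity

lemma fU_lt (h1 : 1 < E1) (h12 : E1 ≤ E2) (hx : 0 < x) (hx1 : x < 1) (y : ℝ) : fU E1 E2 x y < 1 := by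
  have a := fA_lt h1 y
  have b := fA_lt (h1.trans_le h12) y
  unfold fU; nlinarith

lemma fV_le (h1 : 1 < E1) (h12 : E1 ≤ E2) (hx : 0 < x) (hx1 : x < 1) (y : ℝ) : fV E1 E2 x y ≤ 1 - fU E1 E2 x y := by
  have a := fB_le h1 y
  have b := fB_le (h1.trans_le h12) y
  unfold fV fU; nlinarith

lemma fV_ge (h1 : 1 < E1) (h12 : E1 ≤ E2) (hx : 0 < x) (hx1 : x < 1) (y : ℝ) (hy : 0 ≤ y) : 1 - fU E1 E2 x y ≤ (1 + E2) * fV E1 E2 x y := by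
  have a := fB_ge h1 y hy
  have b := fB_ge (h1.trans_le h12) y hy
  have a' : (1 + E1) * fB E1 y ≤ (1 + E2) * fB E1 y :=
    mul_le_mul_of_nonneg_right (by linarith) (fB_pos h1 y).le
  have a2 := mul_le_mul_of_nonneg_left (a.trans a') hx.le
  have b2 := mul_le_mul_of_nonneg_left b (show 0 ≤ 1 - x by linarith)
  unfold fV fU; linarith

lemma fW_abs (h1 : 1 < E1) (h12 : E1 ≤ E2) (hx : 0 < x) (hx1 : x < 1) (y : ℝ) : |fW E1 E2 x y| ≤ fV E1 E2 x y := by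
  have a := fC_abs h1 y
  have b := fC_abs (h1.trans_le h12) y
  have : 0 < 1 - x := by linarith
  unfold fW fV
  refine (abs_add_le _ _).trans ?_
  rw [abs_mul, abs_mul, abs_of_pos hx, abs_of_pos this]
  gcongr

lemma fT_abs (h1 : 1 < E1) (h12 : E1 ≤ E2) (hx : 0 < x) (hx1 : x < 1) (y : ℝ) : |fT E1 E2 x y| ≤ 3 * fV E1 E2 x y := by
  have a := fD_abs h1 y
  have b := fD_abs (h1.trans_le h12) y
  have : 0 < 1 - x := by linarith
  unfold fT fV
  refine (abs_add_le _ _).trans ?_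
  rw [abs_mul, abs_mul, abs_of_pos hx, abs_of_pos this]
  have a2 := mul_le_mul_of_nonneg_left a hx.le
  have b2 := mul_le_mul_of_nonneg_left b this.le
  linarith

lemma fU_def_le (h1 : 1 < E1) (h12 : E1 ≤ E2) (hx : 0 < x) (hx1 : x < 1) (y : ℝ) : 1 - fU E1 E2 x y ≤ (1 + E2) * Real.exp (-y) := by
  have a := fA_def_le h1 y
  have b := fA_def_le (h1.trans_le h12) y
  have a' : (1 + E1) * Real.exp (-y) ≤ (1 + E2) * Real.exp (-y) :=
    mul_le_mul_of_nonneg_right (by linarith) (Real.exp_pos _).le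
  have a2 := mul_le_mul_of_nonneg_left (a.trans a') hx.le
  have b2 := mul_le_mul_of_nonneg_left b (show 0 ≤ 1 - x by linarith)
  unfold fU; linarith

lemma fU_deriv (h1 : 1 < E1) (h12 : E1 ≤ E2) (hx : 0 < x) (hx1 : x < 1) (y : ℝ) : HasDerivAt (fU E1 E2 x) (fV E1 E2 x y) y :=
  ((fA_deriv h1 y).const_mul x).add ((fA_deriv (h1.trans_le h12) y).const_mul (1-x))
lemma fV_deriv (h1 : 1 < E1) (h12 : E1 ≤ E2) (hx : 0 < x) (hx1 : x < 1) (y : ℝ) : HasDerivAt (fV E1 E2 x) (fW E1 E2 x y) y :=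
  ((fB_deriv h1 y).const_mul x).add ((fB_deriv (h1.trans_le h12) y).const_mul (1-x))
lemma fW_deriv (h1 : 1 < E1) (h12 : E1 ≤ E2) (hx : 0 < x) (hx1 : x < 1) (y : ℝ) : HasDerivAt (fW E1 E2 x) (fT E1 E2 x y) y :=
  ((fC_deriv h1 y).const_mul x).add ((fC_deriv (h1.trans_le h12) y).const_mul (1-x))

lemma nice (h1 : 1 < E1) (h12 : E1 ≤ E2) (hx : 0 < x) (hx1 : x < 1) : NiceFlow (fU E1 E2 x) (fV E1 E2 x) (fW E1 E2 x) (1 + E2) where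
  smooth := by
    have := fA_smooth h1
    have := fA_smooth (h1.trans_le h12)
    unfold fU; fun_prop
  dU := fU_deriv h1 h12 hx hx1
  dV := fV_deriv h1 h12 hx hx1
  cW := continuous_iff_continuousAt.2 fun y => (fW_deriv h1 h12 hx hx1 y).continuousAt
  hC := by linarith
  nonneg := fun y hy => by
    have a := fA_nonneg h1 y hy
    have b := fA_nonneg (h1.trans_le h12) y hy
    have : 0 < 1 - x := by linarith
    unfold fU; positivity
  le_one := fun y _ => (fU_lt h1 h12 hx hx1 y).le
  zero := by simp [fU, fA]
  b0 := fun y _ => fU_def_le h1 h12 hx hx1 y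
  b1 := fun y _ => by
    rw [abs_of_pos (fV_pos h1 h12 hx hx1 y)]
    exact (fV_le h1 h12 hx hx1 y).trans (fU_def_le h1 h12 hx hx1 y)
  b2 := fun y _ => ((fW_abs h1 h12 hx hx1 y).trans (fV_le h1 h12 hx hx1 y)).trans
    (fU_def_le h1 h12 hx hx1 y)

lemma fW_far (h1 : 1 < E1) (h12 : E1 ≤ E2) (hx : 0 < x) (hx1 : x < 1) (y : ℝ) (hy : Real.log (3 * E2) ≤ y) : fW E1 E2 x y ≤ -(fV E1 E2 x y / 2) := by
  have hy' : 3 * E2 ≤ Real.exp y := (Real.log_le_iff_le_exp (by linarith)).1 hy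
  have a := fC_far h1 y (by linarith)
  have b := fC_far (h1.trans_le h12) y hy'
  have a2 := mul_le_mul_of_nonneg_left a hx.le
  have b2 := mul_le_mul_of_nonneg_left b (show 0 ≤ 1 - x by linarith)
  unfold fW fV; linarith

lemma fW_zero (h1 : 1 < E1) (h12 : E1 ≤ E2) (hx : 0 < x) (hx1 : x < 1) : 0 < fW E1 E2 x 0 := by
  have a := fC_zero h1
  have b := fC_zero (h1.trans_le h12)
  have : 0 < 1 - x := by linarith
  unfold fW; positivity

lemma fW_finite (h1 : 1 < E1) (h12 : E1 ≤ E2) (hx : 0 < x) (hx1 : x < 1) : {y : ℝ | 0 < y ∧ fW E1 E2 x y = 0}.Finite := by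
  by_contra hinf
  have hsub : {y : ℝ | 0 < y ∧ fW E1 E2 x y = 0} ⊆ Icc 0 (Real.log (3 * E2)) := by
    rintro y ⟨hy, hy0⟩
    refine ⟨hy.le, ?_⟩
    by_contra! h
    have := fW_far h1 h12 hx hx1 y h.le
    have := fV_pos h1 h12 hx hx1 y
    linarith
  obtain ⟨z, hz, hacc⟩ := Set.Infinite.exists_accPt_of_subset_isCompact hinf isCompact_Icc hsub
  have hfreq : ∃ᶠ y in nhdsWithin z {z}ᶜ, fW E1 E2 x y = (fun _ => (0:ℝ)) y :=
    (accPt_iff_frequently_nhdsNE.1 hacc).mono fun y hy => hy.2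
  have han : AnalyticOnNhd ℝ (fW E1 E2 x) univ := fun y _ => by
    have := fC_analytic h1 y
    have := fC_analytic (h1.trans_le h12) y
    unfold fW; fun_prop
  have := han.eq_of_frequently_eq (fun y _ => analyticAt_const) hfreq
  have h0 : fW E1 E2 x 0 = 0 := congrFun this 0
  have := fW_zero h1 h12 hx hx1
  linarith

lemma admissible (h1 : 1 < E1) (h12 : E1 ≤ E2) (hx : 0 < x) (hx1 : x < 1) : AdmissibleShearFlow (fU E1 E2 x) := by
  have n := nice h1 h12 hx hx1
  have d1 : deriv (fU E1 E2 x) = fV E1 E2 x := n.derivU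
  have d2 : iteratedDeriv 2 (fU E1 E2 x) = fW E1 E2 x := by
    rw [iteratedDeriv_succ, iteratedDeriv_one, d1]
    exact funext fun y => (n.dV y).deriv
  have d3 : iteratedDeriv 3 (fU E1 E2 x) = fT E1 E2 x := by
    rw [iteratedDeriv_succ, d2]
    exact funext fun y => (fW_deriv h1 h12 hx hx1 y).deriv
  have hC : 0 < 1 + E2 := by linarith
  have V1 : ∀ y, 0 ≤ y → fV E1 E2 x y ≤ 1 := fun y hy => by
    have := fV_le h1 h12 hx hx1 y
    have := n.nonneg y hy
    linarith
  have hratio : ∀ y, 0 ≤ y → (1 - fU E1 E2 x y)^2 / fV E1 E2 x y ≤ (1 + E2) * (1 - fU E1 E2 x y) := by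
    intro y hy
    have hp := fV_pos h1 h12 hx hx1 y
    rw [div_le_iff₀ hp, sq]
    have := mul_le_mul_of_nonneg_left (fV_ge h1 h12 hx hx1 y hy)
      (show 0 ≤ 1 - fU E1 E2 x y by linarith [n.le_one y hy])
    linarith
  refine ⟨n.smooth, fun y hy => ⟨n.nonneg y hy, fU_lt h1 h12 hx hx1 y⟩, n.zero, ?_, n.tendsto_one, ?_, ?_,
    n.intble_defect, ?_, ?_, n.y_defect, ?_, ?_⟩
  · intro y _; rw [d1]; exact fV_pos h1 h12 hx hx1 y
  · rw [d2]; exact (fW_zero h1 h12 hx hx1).ne'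
  · rw [d2]; exact fW_finite h1 h12 hx hx1
  · intro j hj1 hj3
    refine ⟨3, fun y hy => ?_⟩
    have v1 := V1 y hy
    have v0 := fV_pos h1 h12 hx hx1 y
    interval_cases j
    · rw [iteratedDeriv_one, d1, abs_of_pos v0]; linarith
    · rw [d2]; linarith [fW_abs h1 h12 hx hx1 y]
    · rw [d3]; linarith [fT_abs h1 h12 hx hx1 y]
  · rw [d1]
    refine squeeze_zero' (g := fun y => (1 + E2) * (1 - fU E1 E2 x y)) ?_ ?_ ?_
    · filter_upwards with y
      have := fV_pos h1 h12 hx hx1 y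
      positivity
    · filter_upwards [eventually_ge_atTop 0] with y hy using hratio y hy
    · have := ((tendsto_const_nhds (x := (1:ℝ))).sub n.tendsto_one).const_mul (1 + E2)
      simpa using this
  · rw [d1, d2]
    have hc : Continuous fun y => (1 - fU E1 E2 x y)^2 * fW E1 E2 x y / (fV E1 E2 x y)^2 := by
      have := n.cU
      have := n.cV
      have := n.cW
      exact Continuous.div (by fun_prop) (by fun_prop)
        fun y => pow_ne_zero 2 (fV_pos h1 h12 hx hx1 y).ne'
    refine Integrable.mono' (n.intble_defect.const_mul (1 + E2)) hc.aestronglyMeasurable ?_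
    filter_upwards [ae_restrict_mem measurableSet_Ioi] with y hy
    have hy : 0 ≤ y := le_of_lt hy
    have hp := fV_pos h1 h12 hx hx1 y
    refine le_trans ?_ (hratio y hy)
    rw [Real.norm_eq_abs, abs_div, abs_mul, abs_of_nonneg (sq_nonneg _), abs_of_pos (pow_pos hp 2)]
    rw [div_le_div_iff₀ (by positivity) hp]
    have := mul_le_mul_of_nonneg_left (fW_abs h1 h12 hx hx1 y)
      (show 0 ≤ (1 - fU E1 E2 x y)^2 * fV E1 E2 x y by positivity)
    linarith
  · refine ⟨1/4, by norm_num, by norm_num, Real.log (3 * E2), Real.log_pos (by linarith), 1/2, by norm_num,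
      fun y hy => ?_⟩
    rw [d1, d2]
    have hy0 : 0 ≤ y := (Real.log_nonneg (by linarith)).trans hy
    have hp := fV_pos h1 h12 hx hx1 y
    have hd : 0 < 1 - fU E1 E2 x y := by linarith [fU_lt h1 h12 hx hx1 y]
    have hd1 : 1 - fU E1 E2 x y ≤ 1 := by linarith [n.nonneg y hy0]
    have hle := fV_le h1 h12 hx hx1 y
    have hw := fW_far h1 h12 hx hx1 y hy
    have hpow : (1 - fU E1 E2 x y)^2 ≤ (1 - fU E1 E2 x y)^((2:ℝ) - 1/4) := by
      rw [← Real.rpow_natCast]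
      exact Real.rpow_le_rpow_of_exponent_ge hd hd1 (by norm_num)
    have hv2 : (fV E1 E2 x y)^2 ≤ (1 - fU E1 E2 x y)^((2:ℝ) - 1/4) :=
      (pow_le_pow_left₀ hp.le hle 2).trans hpow
    have hq : 0 ≤ (1 - fU E1 E2 x y)^((2:ℝ) - 1/4) := (sq_nonneg _).trans hpow
    generalize (1 - fU E1 E2 x y)^((2:ℝ) - 1/4) = q at *
    have s1 := mul_le_mul_of_nonneg_left hw hq
    have s2 := mul_le_mul_of_nonneg_right hv2 hp.le
    have s3 : (fV E1 E2 x y)^3 = (fV E1 E2 x y)^2 * fV E1 E2 x y := by ring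
    rw [s3]; linarith

end flow

end

section

/-! ### Estimate of the inviscid dispersion function -/

lemma hker_lip (z : ℂ) (b0 C0 : ℝ) (hb0 : 0 < b0) (hz : b0 ≤ z.im) (hC : ‖z‖ ≤ C0) (s t : ℝ)
    (hs0 : 0 ≤ s) (hs1 : s ≤ 1) (ht0 : 0 ≤ t) (ht1 : t ≤ 1) :
    ‖hker s z - hker t z‖ ≤ (C0 + 1)^2 * (2 * C0 + 2) * (b0⁻¹)^4 * |s - t| := by
  have him : 0 < z.im := by linarith
  have n1 := Coef.den_ne z him s
  have n2 := Coef.den_ne z him t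
  have d1 := Coef.den_bound z b0 hb0 hz s
  have d2 := Coef.den_bound z b0 hb0 hz t
  have hC0 : 0 ≤ C0 := (norm_nonneg _).trans hC
  have e : hker s z - hker t z = (z - 1)^2 * (2 * z - s - t) *
      ((z - s)⁻¹^2 * (z - t)⁻¹^2) * ((t - s : ℝ) : ℂ) * (-1) ∨ hker s z - hker t z =
      (z - 1)^2 * (2 * z - s - t) * ((z - s)⁻¹^2 * (z - t)⁻¹^2) * ((t - s : ℝ) : ℂ) := by
    right
    unfold hker
    field_simp
    push_cast
    ring
  have a1 : ‖z - 1‖ ≤ C0 + 1 := (norm_sub_le _ _).trans (by rw [norm_one]; linarith)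
  have a2 : ‖2 * z - s - t‖ ≤ 2 * C0 + 2 := by
    have b1 : ‖(s:ℂ)‖ ≤ 1 := by rw [Complex.norm_real, Real.norm_eq_abs, abs_of_nonneg hs0]; exact hs1
    have b2 : ‖(t:ℂ)‖ ≤ 1 := by rw [Complex.norm_real, Real.norm_eq_abs, abs_of_nonneg ht0]; exact ht1
    have b3 : ‖2 * z‖ ≤ 2 * C0 := by rw [norm_mul, Complex.norm_ofNat]; linarith
    have := norm_sub_le (2 * z - s) t
    have := norm_sub_le (2 * z) s
    linarith
  have hn : ‖(z - 1)^2 * (2 * z - s - t) * ((z - s)⁻¹^2 * (z - t)⁻¹^2) * ((t - s : ℝ) : ℂ)‖ ≤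
      (C0 + 1)^2 * (2 * C0 + 2) * (b0⁻¹)^4 * |s - t| := by
    rw [norm_mul, norm_mul, norm_mul, norm_mul, norm_pow, norm_pow, norm_pow, Complex.norm_real,
      Real.norm_eq_abs, abs_sub_comm t s]
    calc _ ≤ (C0 + 1)^2 * (2 * C0 + 2) * ((b0⁻¹)^2 * (b0⁻¹)^2) * |s - t| := by gcongr
      _ = _ := by ring
  rcases e with e | e <;> rw [e]
  · rw [norm_mul, norm_neg, norm_one, mul_one]; exact hn
  · exact hn

lemma fA_step (l y : ℝ) (hl : 0 < l) (hy : 0 ≤ y) :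
    |fA (Real.exp l) y - (if l < y then 1 else 0)| ≤ 2 * Real.exp (-|y - l|) := by
  have hE : 1 < Real.exp l := by rw [← Real.exp_zero]; exact Real.exp_lt_exp.2 hl
  have hp := fpos hE y
  have e1 := Real.exp_pos y
  have e2 := Real.exp_pos l
  split_ifs with h
  · rw [abs_sub_comm, abs_of_pos (by linarith [fA_lt hE y]), abs_of_pos (by linarith), fA_sub hE,
      neg_sub, Real.exp_sub, ← mul_div_assoc, div_le_div_iff₀ hp e1]
    nlinarith
  · rw [sub_zero, abs_of_nonneg (fA_nonneg hE y hy), abs_of_nonpos (by linarith), neg_neg,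
      Real.exp_sub, fA, ← mul_div_assoc, div_le_div_iff₀ hp e2]
    nlinarith

lemma intble_exp_abs (l : ℝ) : Integrable (fun y : ℝ => Real.exp (-|y - l|)) := by
  have h0 : Integrable (fun y : ℝ => Real.exp (-|y|)) := by
    rw [← integrableOn_univ, ← Iic_union_Ioi (a := (0:ℝ))]
    refine IntegrableOn.union ?_ ?_
    · refine (integrableOn_exp_Iic 0).congr_fun (fun y hy => ?_) measurableSet_Iic
      rw [abs_of_nonpos hy, neg_neg]
    · refine (integrableOn_exp_neg_Ioi 0).congr_fun (fun y hy => ?_) measurableSet_Ioi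
      simp only
      rw [abs_of_pos hy]
  exact h0.comp_sub_right l

def cM : ℝ := ∫ y : ℝ, Real.exp (-|y|)

lemma int_exp_abs_le (l : ℝ) : ∫ y in Ioi (0:ℝ), Real.exp (-|y - l|) ≤ cM := by
  refine (setIntegral_le_integral (intble_exp_abs l) (Eventually.of_forall fun y => (Real.exp_pos _).le)).trans ?_
  rw [integral_sub_right_eq_self (fun y : ℝ => Real.exp (-|y|)) l]
  exact le_rfl

/-- the limiting two-step profile -/
def stepS (l1 l2 x y : ℝ) : ℝ := x * (if l1 < y then 1 else 0) + (1 - x) * (if l2 < y then 1 else 0)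

lemma int_step (l1 l2 x : ℝ) (h1 : 0 < l1) (h2 : l1 ≤ l2) (z : ℂ) :
    IntegrableOn (fun y => hker (stepS l1 l2 x y) z) (Ioi 0) ∧
    ∫ y in Ioi (0:ℝ), hker (stepS l1 l2 x y) z = l1 * hker 0 z + (l2 - l1) * hker x z := by
  have e : EqOn (fun y => hker (stepS l1 l2 x y) z)
      (fun y => (Ioc 0 l1).indicator (fun _ => hker 0 z) y + (Ioc l1 l2).indicator (fun _ => hker x z) y)
      (Ioi 0) := by
    intro y hy
    have hy : 0 < y := hy
    simp only [stepS, indicator, mem_Ioc]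
    by_cases a : l1 < y
    · by_cases b : l2 < y
      · have b' : ¬ y ≤ l2 := not_le.2 b
        have a' : ¬ y ≤ l1 := not_le.2 a
        simp [a, b, a', b', hker]
      · have b' : y ≤ l2 := not_lt.1 b
        have a' : ¬ y ≤ l1 := not_le.2 a
        simp [a, b, a', b']
    · have b : ¬ l2 < y := fun h => a (by linarith)
      have a' : y ≤ l1 := not_lt.1 a
      simp [a, b, a', hy]
  have i1 : Integrable ((Ioc 0 l1).indicator (fun _ => hker 0 z)) (volume.restrict (Ioi (0:ℝ))) :=
    ((integrable_indicator_iff measurableSet_Ioc).2 (integrableOn_const (by simp))).restrict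
  have i2 : Integrable ((Ioc l1 l2).indicator (fun _ => hker x z)) (volume.restrict (Ioi (0:ℝ))) :=
    ((integrable_indicator_iff measurableSet_Ioc).2 (integrableOn_const (by simp))).restrict
  refine ⟨IntegrableOn.congr_fun (i1.add i2) (fun y hy => (e hy).symm) measurableSet_Ioi, ?_⟩
  rw [setIntegral_congr_fun measurableSet_Ioi e, integral_add i1 i2,
    setIntegral_indicator measurableSet_Ioc, setIntegral_indicator measurableSet_Ioc,
    inter_eq_self_of_subset_right (show Ioc 0 l1 ⊆ Ioi 0 from fun y hy => hy.1),
    inter_eq_self_of_subset_right (show Ioc l1 l2 ⊆ Ioi 0 from fun y hy => h1.trans hy.1), setIntegral_const, setIntegral_const]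
  simp [Measure.real, h1.le, h2]

lemma phi_est (l1 l2 x : ℝ) (h1 : 0 < l1) (h2 : l1 ≤ l2) (hx : 0 < x) (hx1 : x < 1) (z : ℂ) (b0 C0 : ℝ)
    (hb0 : 0 < b0) (hz : b0 ≤ z.im) (hC : ‖z‖ ≤ C0) :
    ‖(∫ y in Ioi (0:ℝ), hker (fU (Real.exp l1) (Real.exp l2) x y) z) -
      (l1 * hker 0 z + (l2 - l1) * hker x z)‖ ≤ (C0 + 1)^2 * (2 * C0 + 2) * (b0⁻¹)^4 * (2 * cM) := by
  have hE : 1 < Real.exp l1 := by rw [← Real.exp_zero]; exact Real.exp_lt_exp.2 h1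
  have n := nice hE (Real.exp_le_exp.2 h2) hx hx1
  obtain ⟨i, hi⟩ := int_step l1 l2 x h1 h2 z
  have him : 0 < z.im := by linarith
  have hC0 : 0 ≤ C0 := (norm_nonneg _).trans hC
  set K := (C0 + 1)^2 * (2 * C0 + 2) * (b0⁻¹)^4 with hK
  have hK0 : 0 ≤ K := by positivity
  rw [← hi, ← integral_sub (n.intble_hker z him) i]
  have ig : Integrable (fun y => K * (2 * (x * Real.exp (-|y - l1|) + (1 - x) * Real.exp (-|y - l2|))))
      (volume.restrict (Ioi (0:ℝ))) :=
    (((((intble_exp_abs l1).const_mul x).add ((intble_exp_abs l2).const_mul (1-x))).const_mul 2).const_mul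
      K).restrict
  refine (norm_integral_le_of_norm_le ig ?_).trans ?_
  · filter_upwards [ae_restrict_mem measurableSet_Ioi] with y hy
    have hy : 0 ≤ y := le_of_lt hy
    have s0 : 0 ≤ stepS l1 l2 x y := by
      have : 0 < 1 - x := by linarith
      unfold stepS; split_ifs <;> simp <;> linarith
    have s1 : stepS l1 l2 x y ≤ 1 := by
      unfold stepS; split_ifs <;> simp <;> linarith
    refine (hker_lip z b0 C0 hb0 hz hC _ _ (n.nonneg y hy) (n.le_one y hy) s0 s1).trans ?_
    refine mul_le_mul_of_nonneg_left ?_ hK0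
    have f1 := fA_step l1 y h1 hy
    have f2 := fA_step l2 y (h1.trans_le h2) hy
    have hxp : 0 < 1 - x := by linarith
    have : fU (Real.exp l1) (Real.exp l2) x y - stepS l1 l2 x y =
        x * (fA (Real.exp l1) y - (if l1 < y then 1 else 0)) +
        (1 - x) * (fA (Real.exp l2) y - (if l2 < y then 1 else 0)) := by
      unfold fU stepS; ring
    rw [this]
    refine (abs_add_le _ _).trans ?_
    rw [abs_mul, abs_mul, abs_of_pos hx, abs_of_pos hxp]
    have g1 := mul_le_mul_of_nonneg_left f1 hx.le
    have g2 := mul_le_mul_of_nonneg_left f2 hxp.le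
    linarith
  · rw [integral_const_mul, integral_const_mul, integral_add
      (((intble_exp_abs l1).const_mul x).restrict) (((intble_exp_abs l2).const_mul (1-x)).restrict),
      integral_const_mul, integral_const_mul]
    refine mul_le_mul_of_nonneg_left ?_ hK0
    have g1 := mul_le_mul_of_nonneg_left (int_exp_abs_le l1) hx.le
    have g2 := mul_le_mul_of_nonneg_left (int_exp_abs_le l2) (show 0 ≤ 1 - x by linarith)
    linarith

lemma main_construction (μ : ℂ) (ha : 0 < μ.re) (ha1 : μ.re < 2/3)
    (hb : 0 < μ.im) (hb1 : μ.im < Real.sqrt (μ.re * (2 - 3 * μ.re) / 3))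
    (ε : ℝ) (hε : 0 < ε) :
    ∃ U : ℝ → ℝ, AdmissibleShearFlow U ∧ ∃ K : ℝ, 0 < K ∧ ∃ γp : ℝ, 0 < γp ∧
      ∀ k : ℕ, K ≤ (k : ℝ) → ∀ ν : ℝ, 0 < ν → (Real.sqrt ν * (k : ℝ))⁻¹ ≤ γp →
        ∃ μk : ℂ, 0 < μk.im ∧ ‖μk - μ‖ ≤ ε ∧
          ∃ φ : ℝ → ℂ,
            IsEigSolution U μk (k : ℝ) ((((Real.sqrt ν * (k : ℝ))⁻¹ : ℝ)) : ℂ) φ := by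
  have hb2 : μ.im^2 < μ.re * (2 - 3 * μ.re) / 3 := (Real.lt_sqrt hb.le).1 hb1
  obtain ⟨x, β, hx, hx1, hβ, hH⟩ := gamma2_algebra μ ha ha1 hb hb2
  obtain ⟨r, η, hr, hrε, hrb, hη, hs⟩ := H_isolated μ hb x β hx ε hε
  set b0 := μ.im / 2 with hb0
  have hb0p : 0 < b0 := by positivity
  set C0 := ‖μ‖ + r with hC0
  have hC0p : 0 ≤ C0 := by positivity
  have hball : ∀ z : ℂ, ‖z - μ‖ ≤ r → b0 ≤ z.im ∧ ‖z‖ ≤ C0 := by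
    intro z hz
    have h1 := Complex.abs_im_le_norm (z - μ)
    rw [Complex.sub_im] at h1
    have h2 := (abs_le.1 (h1.trans hz)).1
    have h3 : ‖z‖ ≤ ‖μ‖ + ‖z - μ‖ := by
      have := norm_add_le μ (z - μ)
      rwa [add_sub_cancel] at this
    exact ⟨by linarith, by linarith⟩
  set D := (C0 + 1)^2 * (2 * C0 + 2) * (b0⁻¹)^4 * (2 * cM) with hD
  have hD0 : 0 ≤ D := by
    have := phi_est 1 1 x one_pos le_rfl hx hx1 μ b0 C0 hb0p (by linarith) (by linarith)
    exact (norm_nonneg _).trans this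
  set L := (2 * D + 5) / η with hL
  have hLp : 0 < L := by positivity
  have hLη : L * η = 2 * D + 5 := by rw [hL]; field_simp
  have h12 : L ≤ L * (1 + β) := by nlinarith
  have hE : 1 < Real.exp L := by rw [← Real.exp_zero]; exact Real.exp_lt_exp.2 hLp
  have hE2 := Real.exp_le_exp.2 h12
  have n := nice hE hE2 hx hx1
  obtain ⟨K, hK1, hK⟩ := n.toCoef.visc b0 C0 hb0p hC0p
  have hest : ∀ z : ℂ, ‖z - μ‖ ≤ r → ∀ h : 0 < z.im,
      ‖opEll (n.toCoef.v0 z h) - L * (hker 0 z + β * hker x z)‖ ≤ D := by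
    intro z hz h
    have := phi_est L (L * (1 + β)) x hLp h12 hx hx1 z b0 C0 hb0p (hball z hz).1 (hball z hz).2
    rw [n.ell_v0' z h]
    convert this using 3
    push_cast; ring
  refine ⟨fU (Real.exp L) (Real.exp (L * (1 + β))) x, admissible hE hE2 hx hx1, K, by linarith, 1/2,
    by norm_num, fun k hk ν hν hνk => ?_⟩
  have hkp : (0:ℝ) < k := by linarith
  have hγ0 : 0 ≤ (Real.sqrt ν * (k : ℝ))⁻¹ := by positivity
  generalize (Real.sqrt ν * (k : ℝ))⁻¹ = γ at *
  obtain ⟨X, hX⟩ := hK k hk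
  have hγn : ‖(γ:ℂ)‖ ≤ 1/2 := by
    rw [Complex.norm_real, Real.norm_eq_abs, abs_of_nonneg hγ0]; exact hνk
  have him : ∀ z : ℂ, ‖z - μ‖ ≤ r → 0 < z.im := fun z hz => hb0p.trans_le (hball z hz).1
  have hclose : ∀ z : ℂ, ‖z - μ‖ ≤ r →
      ‖(opEll (X z) - γ) - L * (hker 0 z + β * hker x z)‖ ≤ D + 3/2 := by
    intro z hz
    have h := him z hz
    have e1 := hest z hz h
    have e2 := (hX z h (hball z hz).1 (hball z hz).2).2.1
    have : (opEll (X z) - γ) - L * (hker 0 z + β * hker x z) =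
        (opEll (X z) - opEll (n.toCoef.v0 z h)) +
          (opEll (n.toCoef.v0 z h) - L * (hker 0 z + β * hker x z)) - γ := by ring
    rw [this]
    refine (norm_sub_le _ _).trans ?_
    have := norm_add_le (opEll (X z) - opEll (n.toCoef.v0 z h))
          (opEll (n.toCoef.v0 z h) - L * (hker 0 z + β * hker x z))
    linarith
  obtain ⟨z, hz, hz0⟩ := exists_zero_of_small_center (fun z => opEll (X z) - γ) μ r (D + 3/2) hr
    (fun z hz => by
      have := (hX z (him z hz) (hball z hz).1 (hball z hz).2).1
      exact (opEll.differentiableAt.comp z this).sub_const _)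
    (by
      have := hclose μ (by simpa using hr.le)
      rwa [hH, mul_zero, sub_zero] at this) (D + 5/2) (by linarith)
    (fun z hz => by
      have e1 := hclose z hz.le
      have e2 := mul_le_mul_of_nonneg_left (hs z hz) hLp.le
      have e3 : ‖(L:ℂ) * (hker 0 z + β * hker x z)‖ = L * ‖hker 0 z + β * hker x z‖ := by
        rw [norm_mul, Complex.norm_real, Real.norm_eq_abs, abs_of_pos hLp]
      have e4 := norm_sub_norm_le ((L:ℂ) * (hker 0 z + β * hker x z)) (opEll (X z) - γ)
      rw [norm_sub_rev ((L:ℂ) * (hker 0 z + β * hker x z)) (opEll (X z) - γ)] at e4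
      linarith)
  obtain ⟨-, -, x1, x2, d1, d2, d3, d4⟩ := hX z (him z hz) (hball z hz).1 (hball z hz).2
  obtain ⟨φ, hφ⟩ := n.recon z k hkp (X z) x1 x2 d1 d2 d3 d4
  rw [sub_eq_zero.1 hz0] at hφ
  exact ⟨z, him z hz, hz.trans hrε, φ, hφ⟩

end

/-- Theorem (construction of unstable shear flows for IBL, spectral domain `Γ₂`). -/
theorem ibl_construction_gamma2 (μ : ℂ) (ha : 0 < μ.re) (ha1 : μ.re < 2/3)
    (hb : 0 < μ.im) (hb1 : μ.im < Real.sqrt (μ.re * (2 - 3 * μ.re) / 3))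
    (ε : ℝ) (hε : 0 < ε) :
    ∃ U : ℝ → ℝ, AdmissibleShearFlow U ∧ ∃ K : ℝ, 0 < K ∧ ∃ γp : ℝ, 0 < γp ∧
      ∀ k : ℕ, K ≤ (k : ℝ) → ∀ ν : ℝ, 0 < ν → (Real.sqrt ν * (k : ℝ))⁻¹ ≤ γp →
        ∃ μk : ℂ, 0 < μk.im ∧ ‖μk - μ‖ ≤ ε ∧
          ∃ φ : ℝ → ℂ,
            IsEigSolution U μk (k : ℝ) ((((Real.sqrt ν * (k : ℝ))⁻¹ : ℝ)) : ℂ) φ := by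
  exact main_construction μ ha ha1 hb hb1 ε hε

end
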